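/- arXiv:2506.13962 — 4 statements merged into one kernel-verified Lean document; each statement's English description precedes it below -/
import Mathlib

section
/- For every natural number n ≥ 9 with n ≡ 4 (mod 5), there exists a set A of 3 partial transformations of an n-element set such that A admits a carefully synchronising word, and every carefully synchronising word for A has length at least 4^((n−4)/5). -/
/-- Applying a word (list) of partial transformations of `Fin n` to a state `q`,
composing from left to right, with `none` (undefined) propagating. -/
def ptApply {n : ℕ} (w : List (Fin n → Option (Fin n))) (q : Fin n) : Option (Fin n) :=
  w.foldl (fun o f => o.bind f) (some q)

/-- A word `w` over the alphabet `A` is carefully synchronising: all its letters are in `A`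
and it maps every state to one common state `q₀`. -/
def CarefullySync {n : ℕ} (A : Finset (Fin n → Option (Fin n)))
    (w : List (Fin n → Option (Fin n))) : Prop :=
  (∀ g ∈ w, g ∈ A) ∧ ∃ q₀ : Fin n, ∀ q : Fin n, ptApply w q = some q₀

/-! ### Generic automata and transfer to `Fin n` -/

/-- Running a word of letters in a partial automaton. -/
def srun {Q L : Type} (δ : L → Q → Option Q) : List L → Q → Option Q
  | [], q => some q
  | a :: w, q => (δ a q).bind (srun δ w)

theorem srun_append {Q L : Type} (δ : L → Q → Option Q) (u v : List L) (q : Q) :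
    srun δ (u ++ v) q = (srun δ u q).bind (srun δ v) := by
  induction u generalizing q with
  | nil => simp [srun]
  | cons a u ih =>
    simp only [List.cons_append, srun]
    cases h : δ a q with
    | none => simp
    | some x => simp [ih]

theorem ptApply_cons {n : ℕ} (f : Fin n → Option (Fin n)) (w : List (Fin n → Option (Fin n)))
    (q : Fin n) : ptApply (f :: w) q = (f q).bind (ptApply w) := by
  have hnone : ∀ w : List (Fin n → Option (Fin n)),
      w.foldl (fun o f => o.bind f) none = none := by
    intro w
    induction w with
    | nil => rfl
    | cons a w ih => simpa using ih
  unfold ptApply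
  simp only [List.foldl_cons, Option.bind_some]
  cases h : f q with
  | none => simp [hnone]
  | some x => simp

/-- The three letters. -/
inductive Lt
  | T | b | c

theorem transfer {Q : Type} [Fintype Q] (n N : ℕ) (hQ : Fintype.card Q = n)
    (δ : Lt → Q → Option Q) (h1 : δ Lt.T ≠ δ Lt.b) (h2 : δ Lt.T ≠ δ Lt.c) (h3 : δ Lt.b ≠ δ Lt.c)
    (hex : ∃ w q₀, ∀ q, srun δ w q = some q₀)
    (hlow : ∀ w q₀, (∀ q, srun δ w q = some q₀) → N ≤ w.length) :
    ∃ A : Finset (Fin n → Option (Fin n)),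
      A.card = 3 ∧
      (∃ w, CarefullySync A w) ∧
      (∀ w, CarefullySync A w → N ≤ w.length) := by
  classical
  let e : Q ≃ Fin n := Fintype.equivFinOfCardEq hQ
  let F : Lt → Fin n → Option (Fin n) := fun a x => (δ a (e.symm x)).map e
  have hF : ∀ a a', F a = F a' → δ a = δ a' := by
    intro a a' h
    funext q
    have := congrFun h (e q)
    simp only [F, Equiv.symm_apply_apply] at this
    exact Option.map_injective e.injective this
  have hrun : ∀ (w : List Lt) (x : Fin n),
      ptApply (w.map F) x = (srun δ w (e.symm x)).map e := by
    intro w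
    induction w with
    | nil => intro x; simp [ptApply, srun]
    | cons a w ih =>
      intro x
      rw [List.map_cons, ptApply_cons]
      simp only [srun, F]
      cases h : δ a (e.symm x) with
      | none => simp
      | some y =>
        have := ih (e y)
        simp only [F, Equiv.symm_apply_apply] at this
        simpa using this
  refine ⟨{F Lt.T, F Lt.b, F Lt.c}, ?_, ?_, ?_⟩
  · rw [Finset.card_eq_three]
    exact ⟨_, _, _, fun h => h1 (hF _ _ h), fun h => h2 (hF _ _ h), fun h => h3 (hF _ _ h), rfl⟩
  · obtain ⟨w, q₀, hw⟩ := hex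
    refine ⟨w.map F, ?_, e q₀, ?_⟩
    · intro g hg
      obtain ⟨a, -, rfl⟩ := List.mem_map.1 hg
      cases a <;> simp
    · intro q
      rw [hrun, hw]; rfl
  · rintro w ⟨hA, q₀, hq⟩
    have : ∃ u : List Lt, u.map F = w := by
      clear hq
      induction w with
      | nil => exact ⟨[], rfl⟩
      | cons g w ih =>
        obtain ⟨u, hu⟩ := ih (fun g hg => hA g (List.mem_cons_of_mem _ hg))
        have hg := hA g List.mem_cons_self
        simp only [Finset.mem_insert, Finset.mem_singleton] at hg
        rcases hg with h | h | h
        · exact ⟨Lt.T :: u, by simp [hu, h]⟩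
        · exact ⟨Lt.b :: u, by simp [hu, h]⟩
        · exact ⟨Lt.c :: u, by simp [hu, h]⟩
    obtain ⟨u, rfl⟩ := this
    rw [List.length_map]
    apply hlow u (e.symm q₀)
    intro q
    have := hq (e q)
    rw [hrun, Equiv.symm_apply_apply, Option.map_eq_some_iff] at this
    obtain ⟨y, hy, hye⟩ := this
    rw [hy, ← hye, Equiv.symm_apply_apply]

/-! ### Two coprime cycles (small cases) -/

def dcyc (p q : ℕ) : Lt → ZMod p ⊕ ZMod q → Option (ZMod p ⊕ ZMod q)
  | .T, .inl _ => some (.inl 0)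
  | .T, .inr _ => some (.inr 0)
  | .b, .inl x => some (.inl (x + 1))
  | .b, .inr x => some (.inr (x + 1))
  | .c, .inl x => if x + 1 = 0 then some (.inl 0) else none
  | .c, .inr x => if x + 1 = 0 then some (.inl 0) else none

theorem dcyc_low (p q : ℕ) (hpq : Nat.Coprime p q) (w : List Lt) :
    ∀ (t : ℕ) (q₀ : ZMod p ⊕ ZMod q), srun (dcyc p q) w (.inl (t : ZMod p)) = some q₀ →
      srun (dcyc p q) w (.inr (t : ZMod q)) = some q₀ → p * q ≤ w.length + t := by
  induction w with
  | nil =>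
    intro t q₀ h1 h2
    simp only [srun, Option.some.injEq] at h1 h2
    rw [← h2] at h1
    cases h1
  | cons a w ih =>
    intro t q₀ h1 h2
    cases a with
    | T =>
      have := ih 0 q₀ (by simpa [srun, dcyc] using h1) (by simpa [srun, dcyc] using h2)
      simp only [List.length_cons]; omega
    | b =>
      have := ih (t + 1) q₀ (by simpa [srun, dcyc] using h1) (by simpa [srun, dcyc] using h2)
      simp only [List.length_cons]; omega
    | c =>
      simp only [srun, dcyc] at h1 h2
      split_ifs at h1 h2 with h3 h4
      · have h3' : ((t + 1 : ℕ) : ZMod p) = 0 := by exact_mod_cast h3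
        have h4' : ((t + 1 : ℕ) : ZMod q) = 0 := by exact_mod_cast h4
        rw [ZMod.natCast_eq_zero_iff] at h3' h4'
        have := Nat.le_of_dvd (Nat.succ_pos t) (hpq.mul_dvd_of_dvd_of_dvd h3' h4')
        simp only [List.length_cons]; omega
      · simp at h2
      · simp at h1
      · simp at h1

theorem dcyc_rep (p q m : ℕ) :
    (∀ x : ZMod p, srun (dcyc p q) (List.replicate m Lt.b) (.inl x) = some (.inl (x + m))) ∧
    (∀ x : ZMod q, srun (dcyc p q) (List.replicate m Lt.b) (.inr x) = some (.inr (x + m))) := by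
  induction m with
  | zero => simp [srun]
  | succ m ih =>
    constructor
    · intro x
      simp only [List.replicate_succ, srun, dcyc, Option.bind_some, ih.1]
      push_cast; congr 2; ring
    · intro x
      simp only [List.replicate_succ, srun, dcyc, Option.bind_some, ih.2]
      push_cast; congr 2; ring

theorem small_case (n N p q : ℕ) (hp : 2 ≤ p) (hq : 2 ≤ q) (hpq : Nat.Coprime p q)
    (hn : p + q = n) (hN : N ≤ p * q) :
    ∃ A : Finset (Fin n → Option (Fin n)),
      A.card = 3 ∧
      (∃ w, CarefullySync A w) ∧
      (∀ w, CarefullySync A w → N ≤ w.length) := by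
  have : Fact (1 < p) := ⟨hp⟩
  have : Fact (1 < q) := ⟨hq⟩
  have : NeZero p := ⟨by omega⟩
  have : NeZero q := ⟨by omega⟩
  apply transfer (Q := ZMod p ⊕ ZMod q) n N (by simp [ZMod.card, hn]) (dcyc p q)
  · intro h
    have := congrFun h (.inl 0)
    simp [dcyc] at this
  · intro h
    have := congrFun h (.inl 0)
    simp [dcyc] at this
  · intro h
    have := congrFun h (.inl 0)
    simp [dcyc] at this
  · refine ⟨Lt.T :: (List.replicate (p * q - 1) Lt.b ++ [Lt.c]), .inl 0, ?_⟩
    have hpos : 1 ≤ p * q := Nat.mul_pos (by omega) (by omega)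
    have e1 : ((p * q - 1 : ℕ) : ZMod p) + 1 = 0 := by
      have : ((p * q - 1 + 1 : ℕ) : ZMod p) = 0 := by
        rw [Nat.sub_add_cancel hpos]; simp
      exact_mod_cast this
    have e2 : ((p * q - 1 : ℕ) : ZMod q) + 1 = 0 := by
      have : ((p * q - 1 + 1 : ℕ) : ZMod q) = 0 := by
        rw [Nat.sub_add_cancel hpos]; simp
      exact_mod_cast this
    rintro (x | x)
    · simp only [srun, dcyc, Option.bind_some, srun_append, (dcyc_rep p q _).1, zero_add, e1,
        if_true]
    · simp only [srun, dcyc, Option.bind_some, srun_append, (dcyc_rep p q _).2, zero_add, e2,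
        if_true]
  · intro w q₀ h
    have := dcyc_low p q hpq w 0 q₀ (h _) (h _)
    omega


/-! ### The rotating base-4 counter (main case) -/

/-- States: `k` positions carrying a symbol in `0,1,2,3` or the marker `4`; two extra symbols at
position `0` (the pending carry `inl false` and the overflow `inl true`); two unused states. -/
abbrev QQ (k : ℕ) : Type := (ZMod k × Fin 5) ⊕ (Bool ⊕ Bool)

def dm (k : ℕ) : Lt → QQ k → Option (QQ k)
  | .T, .inl (p, _) => if p = 0 then some (.inl (0, 4)) else some (.inl (p, 0))
  | .T, .inr (.inl false) => some (.inl (0, 4))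
  | .T, .inr (.inl true) => some (.inl (1, 0))
  | .T, .inr (.inr _) => some (.inl (0, 4))
  | .b, .inl (p, d) => some (.inl (p - 1, d))
  | .b, .inr _ => none
  | .c, .inl (p, d) =>
      if p = 0 then (if d = 4 then some (.inl (-1, 4)) else none)
      else if p = 1 then
        (if d = 4 then some (.inr (.inl true))
         else if d = 3 then some (.inr (.inl false)) else some (.inl (0, d + 1)))
      else some (.inl (p - 1, d))
  | .c, .inr (.inl false) => some (.inl (-1, 0))
  | .c, .inr (.inl true) => none
  | .c, .inr (.inr _) => none

/-- State of the token of cell `j` at phase `r`; the marker cell is `j = -1`. -/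
def st {k : ℕ} (r : ZMod k) (g : ZMod k → ℕ) (j : ZMod k) : QQ k :=
  if j = -1 then (if g j = 0 then .inl (j + 1 - r, 4) else .inr (.inl true))
  else if g j = 4 then .inr (.inl false) else .inl (j + 1 - r, Fin.ofNat 5 (g j))

def Valid {k : ℕ} (r : ZMod k) (g : ZMod k → ℕ) : Prop :=
  (∀ j, j ≠ -1 → g j ≤ 3 ∨ (g j = 4 ∧ j = r - 1)) ∧ (g (-1) = 0 ∨ (g (-1) = 1 ∧ r = 0))

def VV {k : ℕ} [NeZero k] (g : ZMod k → ℕ) : ℕ := ∑ j, g j * 4 ^ j.val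

theorem VV_update {k : ℕ} [NeZero k] (g : ZMod k → ℕ) (a : ZMod k) (x : ℕ) :
    VV (Function.update g a x) + g a * 4 ^ a.val = VV g + x * 4 ^ a.val := by
  unfold VV
  rw [← Finset.add_sum_erase _ _ (Finset.mem_univ a),
    ← Finset.add_sum_erase (a := a) Finset.univ (fun j => g j * 4 ^ j.val) (Finset.mem_univ a)]
  have : ∑ j ∈ Finset.univ.erase a, Function.update g a x j * 4 ^ j.val
      = ∑ j ∈ Finset.univ.erase a, g j * 4 ^ j.val := by
    apply Finset.sum_congr rfl
    intro j hj
    rw [Function.update_of_ne (Finset.ne_of_mem_erase hj)]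
  rw [this]
  simp only [Function.update_self]
  omega

def nxt {k : ℕ} (r : ZMod k) (g : ZMod k → ℕ) : ZMod k → ℕ :=
  Function.update (Function.update g (r - 1) 0) r (g r + 1)

def Bok {k : ℕ} (g : ZMod k → ℕ) : Prop := (∀ j, j ≠ -1 → g j ≤ 3) ∧ g (-1) = 0

def Cok {k : ℕ} (r : ZMod k) (g : ZMod k → ℕ) : Prop :=
  (r = 0 ∧ g (-1) = 0) ∨ (r ≠ 0 ∧ g (r - 1) = 4)

section
variable {k : ℕ} [Fact (1 < k)]

theorem val_pred [NeZero k] (r : ZMod k) (h : r ≠ 0) : r.val = (r - 1).val + 1 := by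
  have h1 : (r - 1).val = r.val - (1 : ZMod k).val := by
    apply ZMod.val_sub
    rw [ZMod.val_one]
    have := (ZMod.val_eq_zero r).not.2 h
    omega
  rw [ZMod.val_one] at h1
  have := (ZMod.val_eq_zero r).not.2 h
  omega

theorem val_neg_one' [NeZero k] : (-1 : ZMod k).val = k - 1 := by
  obtain ⟨m, rfl⟩ : ∃ m, k = m + 1 := ⟨k - 1, by have := NeZero.ne k; omega⟩
  simp [ZMod.val_neg_one]

theorem nxt_VV [NeZero k] (r : ZMod k) (g : ZMod k → ℕ) :
    VV (nxt r g) + g (r - 1) * 4 ^ (r - 1).val = VV g + 4 ^ r.val := by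
  have h1 := VV_update g (r - 1) 0
  have h2 := VV_update (Function.update g (r - 1) 0) r (g r + 1)
  rw [Function.update_of_ne (fun h => one_ne_zero (α := ZMod k) (by linear_combination h))] at h2
  unfold nxt
  have : (g r + 1) * 4 ^ r.val = g r * 4 ^ r.val + 4 ^ r.val := by ring
  omega

theorem Bok_of (r : ZMod k) (g : ZMod k → ℕ) (hv : Valid r g)
    (h : ∀ j, dm k .b (st r g j) ≠ none) : Bok g := by
  refine ⟨fun j hj => ?_, ?_⟩
  · rcases hv.1 j hj with h1 | h1
    · exact h1
    · exact absurd (by simp [st, hj, h1.1, dm]) (h j)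
  · rcases hv.2 with h1 | h1
    · exact h1
    · exact absurd (by simp [st, h1.1, dm]) (h (-1))

theorem b_step (r : ZMod k) (g : ZMod k → ℕ) (hB : Bok g) :
    Valid (r + 1) g ∧ ∀ j, dm k .b (st r g j) = some (st (r + 1) g j) := by
  refine ⟨⟨fun j hj => Or.inl (hB.1 j hj), Or.inl hB.2⟩, fun j => ?_⟩
  by_cases hj : j = -1
  · subst hj
    simp only [st, hB.2, dm, if_true]
    congr 3; ring
  · have h4 : g j ≠ 4 := by have := hB.1 j hj; omega
    simp only [st, hj, h4, dm, if_false]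
    congr 3; ring

theorem Cok_of (r : ZMod k) (g : ZMod k → ℕ) (hv : Valid r g)
    (h : ∀ j, dm k .c (st r g j) ≠ none) : Cok r g := by
  by_cases hr : r = 0
  · left
    refine ⟨hr, ?_⟩
    rcases hv.2 with h1 | h1
    · exact h1
    · exact absurd (by simp [st, h1.1, dm]) (h (-1))
  · right
    refine ⟨hr, ?_⟩
    have hj : r - 1 ≠ -1 := by
      intro h; apply hr; linear_combination h
    rcases hv.1 _ hj with h1 | h1
    · exfalso
      apply h (r - 1)
      have h4 : g (r - 1) ≠ 4 := by omega
      have h5 : Fin.ofNat 5 (g (r - 1)) ≠ 4 := by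
        generalize g (r - 1) = x at *
        interval_cases x <;> decide
      have hp : r - 1 + 1 - r = 0 := by ring
      simp only [st, hj, h4, dm, if_false, hp, if_true, h5]
    · exact h1.1

theorem c_step (r : ZMod k) (g : ZMod k → ℕ) (hv : Valid r g) (hC : Cok r g) :
    Valid (r + 1) (nxt r g) ∧ ∀ j, dm k .c (st r g j) = some (st (r + 1) (nxt r g) j) := by
  have hne : r - 1 ≠ r := by simp
  have n1 : nxt r g r = g r + 1 := by simp [nxt]
  have n2 : nxt r g (r - 1) = 0 := by
    unfold nxt; rw [Function.update_of_ne hne]; simp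
  have n3 : ∀ j, j ≠ r → j ≠ r - 1 → nxt r g j = g j := by
    intro j h1 h2
    unfold nxt; rw [Function.update_of_ne h1, Function.update_of_ne h2]
  -- facts about the old values
  have o1 : r ≠ -1 → g r ≤ 3 := by
    intro h
    rcases hv.1 r h with h1 | h1
    · exact h1
    · exact absurd h1.2.symm hne
  have o2 : r = -1 → g r = 0 := by
    intro h
    rcases hv.2 with h1 | h1
    · rw [h]; exact h1
    · exfalso
      rw [h1.2] at h
      have : (1 : ZMod k) = 0 := by linear_combination h
      exact one_ne_zero this
  have o3 : ∀ j, j ≠ -1 → j ≠ r - 1 → g j ≤ 3 := by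
    intro j h1 h2
    rcases hv.1 j h1 with h3 | h3
    · exact h3
    · exact absurd h3.2 h2
  have o4 : (-1 : ZMod k) ≠ r - 1 → g (-1) = 0 := by
    intro h
    rcases hv.2 with h1 | h1
    · exact h1
    · exact absurd (by rw [h1.2]; ring) h
  refine ⟨⟨fun j hj => ?_, ?_⟩, fun j => ?_⟩
  · by_cases h1 : j = r
    · subst h1
      rw [n1]
      have := o1 hj
      by_cases h : g j = 3
      · right; exact ⟨by omega, by ring⟩
      · left; omega
    · by_cases h2 : j = r - 1
      · left; rw [h2, n2]; omega
      · left; rw [n3 j h1 h2]; exact o3 j hj h2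
  · by_cases h1 : (-1 : ZMod k) = r
    · right
      rw [h1, n1, o2 h1.symm, ← h1]
      exact ⟨rfl, by ring⟩
    · left
      by_cases h2 : (-1 : ZMod k) = r - 1
      · rw [h2, n2]
      · rw [n3 _ h1 h2]; exact o4 h2
  · by_cases h1 : j = r
    · subst h1
      have hp : j + 1 - j = 1 := by ring
      have hp' : j + 1 - (j + 1) = 0 := by ring
      by_cases hj : j = -1
      · have := o2 hj
        simp only [st, n1, hp, if_pos hj, this, dm, if_true, if_neg (one_ne_zero (α := ZMod k))]
        simp
      · have := o1 hj
        have h4 : g j ≠ 4 := by omega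
        simp only [st, n1, hp, hp', if_neg hj, if_neg h4, dm, if_true,
          if_neg (one_ne_zero (α := ZMod k))]
        generalize g j = x at *
        interval_cases x <;> rfl
    · by_cases h2 : j = r - 1
      · rcases hC with ⟨hr, h0⟩ | ⟨hr, h0⟩
        · have hj : j = -1 := by rw [h2, hr]; ring
          have n2' : nxt r g j = 0 := by rw [h2]; exact n2
          have hp : j + 1 - r = 0 := by rw [h2]; ring
          have hp' : j + 1 - (r + 1) = -1 := by rw [h2]; ring
          have h0' : g j = 0 := by rw [hj]; exact h0
          simp only [st, n2', hp, hp', if_pos hj, h0', dm, if_true]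
        · have hj : j ≠ -1 := by
            intro h; apply hr; linear_combination h - h2
          have n2' : nxt r g j = 0 := by rw [h2]; exact n2
          have hp' : j + 1 - (r + 1) = -1 := by rw [h2]; ring
          have h0' : g j = 4 := by rw [h2]; exact h0
          simp [st, n2', hp', if_neg hj, h0', dm]
      · have hp0 : j + 1 - r ≠ 0 := by
          intro h; apply h2; linear_combination h
        have hp1 : j + 1 - r ≠ 1 := by
          intro h; apply h1; linear_combination h
        have hp : j + 1 - (r + 1) = j + 1 - r - 1 := by ring
        by_cases hj : j = -1
        · have h0 : g j = 0 := by rw [hj]; apply o4; rw [← hj]; exact h2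
          simp only [st, n3 j h1 h2, if_pos hj, h0, dm, if_true, if_neg hp0, if_neg hp1, hp]
        · have h4 : g j ≠ 4 := by have := o3 j hj h2; omega
          simp only [st, n3 j h1 h2, if_neg hj, if_neg h4, dm, if_neg hp0, if_neg hp1, hp]

theorem T_step (r : ZMod k) (g : ZMod k → ℕ) (hv : Valid r g) (h0 : g (-1) = 0) (j : ZMod k) :
    dm k .T (st r g j) = some (st 0 (fun _ => 0) (j - r)) := by
  by_cases hj : j = -1
  · subst hj
    by_cases hr : r = 0
    · subst hr; simp [st, h0, dm]
    · simp [st, h0, dm, hr]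
      ring
  · by_cases h4 : g j = 4
    · have : j = r - 1 := by
        rcases hv.1 j hj with h | h
        · omega
        · exact h.2
      have h' : j - r = -1 := by rw [this]; ring
      simp [st, hj, h4, h', dm]
    · by_cases hp : j + 1 - r = 0
      · have h' : j - r = -1 := by linear_combination hp
        simp [st, hj, h4, dm, hp, h']
      · have h' : j - r ≠ -1 := by
          intro h; apply hp; linear_combination h
        have e : j + 1 - r = j - r + 1 := by ring
        rw [e] at hp
        simp [st, hj, h4, dm, hp, h', e]

theorem main_low [NeZero k] (w : List Lt) :
    ∀ (r : ZMod k) (g : ZMod k → ℕ) (q₀ : QQ k), Valid r g →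
      (∀ j, srun (dm k) w (st r g j) = some q₀) →
      k * 4 ^ (k - 1) ≤ w.length + (k * VV g + (r - 1).val - (k - 1)) := by
  have key : ∀ (r : ZMod k) (g : ZMod k → ℕ), Valid r g → g (-1) ≠ 0 →
      k * 4 ^ (k - 1) ≤ k * VV g + (r - 1).val - (k - 1) := by
    intro r g hv h0
    rcases hv.2 with h | ⟨h, hr⟩
    · exact absurd h h0
    · have h1 : g (-1) * 4 ^ (-1 : ZMod k).val ≤ VV g :=
        Finset.single_le_sum (f := fun j => g j * 4 ^ j.val) (fun _ _ => Nat.zero_le _)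
          (Finset.mem_univ (-1 : ZMod k))
      rw [h, val_neg_one', one_mul] at h1
      have h2 : (r - 1).val = k - 1 := by rw [hr, zero_sub, val_neg_one']
      have := Nat.mul_le_mul_left k h1
      omega
  induction w with
  | nil =>
    intro r g q₀ hv h
    by_cases h0 : g (-1) = 0
    · exfalso
      have h1 := h (-1)
      have h2 := h 0
      rw [← h2] at h1
      have hz : (0 : ZMod k) ≠ -1 := by
        intro h; have : (1 : ZMod k) = 0 := by linear_combination h
        exact one_ne_zero this
      simp only [srun, Option.some.injEq, st, if_true, h0, if_neg hz] at h1
      split_ifs at h1 with h4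
      have hle : g 0 ≤ 3 := by
        rcases hv.1 0 hz with h | h
        · exact h
        · exact absurd h.1 h4
      have h5 := congrArg Prod.snd (Sum.inl.inj h1)
      simp only at h5
      generalize g 0 = x at *
      interval_cases x <;> exact absurd h5 (by decide)
    · have := key r g hv h0
      omega
  | cons a w ih =>
    intro r g q₀ hv h
    by_cases h0 : g (-1) = 0
    swap
    · have := key r g hv h0
      omega
    have hdef : ∀ j, dm k a (st r g j) ≠ none := by
      intro j hj
      have := h j
      simp [srun, hj] at this
    rw [List.length_cons]
    cases a with
    | T =>
      have h1 : ∀ j, srun (dm k) w (st 0 (fun _ => 0) j) = some q₀ := by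
        intro j
        have := h (j + r)
        simpa [srun, T_step r g hv h0] using this
      have := ih 0 (fun _ => 0) q₀ ⟨fun _ _ => Or.inl (Nat.zero_le _), Or.inl rfl⟩ h1
      rw [zero_sub, val_neg_one'] at this
      simp only [VV, zero_mul, Finset.sum_const_zero, mul_zero] at this
      omega
    | b =>
      have hB := Bok_of r g hv hdef
      obtain ⟨hv', hs⟩ := b_step r g hB
      have := ih (r + 1) g q₀ hv' (fun j => by
        have := h j
        simpa [srun, hs] using this)
      rw [add_sub_cancel_right] at this
      by_cases hr : r = 0
      · subst hr; simp only [ZMod.val_zero] at this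
        omega
      · have := val_pred r hr
        omega
    | c =>
      have hC := Cok_of r g hv hdef
      obtain ⟨hv', hs⟩ := c_step r g hv hC
      have := ih (r + 1) (nxt r g) q₀ hv' (fun j => by
        have := h j
        simpa [srun, hs] using this)
      rw [add_sub_cancel_right] at this
      have hV := nxt_VV r g
      rcases hC with ⟨hr, h0⟩ | ⟨hr, h4⟩
      · subst hr
        rw [zero_sub, h0] at hV
        simp only [ZMod.val_zero, zero_mul, pow_zero, add_zero] at hV this
        rw [hV, mul_add] at this
        rw [zero_sub, val_neg_one']
        omega
      · have hp := val_pred r hr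
        rw [h4, hp, pow_succ] at hV
        have hV' : VV (nxt r g) = VV g := by omega
        rw [hV'] at this
        omega

theorem reach_v [NeZero k] (m : ℕ) :
    ∀ (r : ZMod k) (g : ZMod k → ℕ), Valid r g →
      k * (∑ j : ZMod k, 4 * 4 ^ j.val) + k ≤ k * VV g + (r - 1).val + m →
      ∃ (w : List Lt) (r' : ZMod k) (g' : ZMod k → ℕ), Valid r' g' ∧ g' (-1) = 1 ∧
        ∀ j, srun (dm k) w (st r g j) = some (st r' g' j) := by
  induction m with
  | zero =>
    intro r g hv h
    exfalso
    have h1 : VV g ≤ ∑ j : ZMod k, 4 * 4 ^ j.val := by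
      apply Finset.sum_le_sum
      intro j _
      apply Nat.mul_le_mul_right
      by_cases hj : j = -1
      · subst hj; rcases hv.2 with h | h <;> omega
      · rcases hv.1 j hj with h | h <;> omega
    have h2 := Nat.mul_le_mul_left k h1
    have h3 := ZMod.val_lt (r - 1)
    omega
  | succ m ih =>
    intro r g hv h
    by_cases h1 : g (-1) = 1
    · exact ⟨[], r, g, hv, h1, fun j => rfl⟩
    have h0 : g (-1) = 0 := by
      rcases hv.2 with h | h
      · exact h
      · exact absurd h.1 h1
    by_cases hC : Cok r g
    · obtain ⟨hv', hs⟩ := c_step r g hv hC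
      obtain ⟨w, r', g', h1, h2, h3⟩ := ih (r + 1) (nxt r g) hv' (by
        rw [add_sub_cancel_right]
        have hV := nxt_VV r g
        rcases hC with ⟨hr, h0⟩ | ⟨hr, h4⟩
        · subst hr
          rw [zero_sub, h0] at hV
          rw [zero_sub, val_neg_one'] at h
          simp only [ZMod.val_zero, zero_mul, pow_zero, add_zero] at hV ⊢
          rw [hV, mul_add]
          have := NeZero.pos k
          omega
        · have hp := val_pred r hr
          rw [h4, hp, pow_succ] at hV
          have hV' : VV (nxt r g) = VV g := by omega
          rw [hV']
          omega)
      exact ⟨Lt.c :: w, r', g', h1, h2, fun j => by simp [srun, hs, h3]⟩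
    · have hr : r ≠ 0 := fun hr => hC (Or.inl ⟨hr, h0⟩)
      have hB : Bok g := by
        refine ⟨fun j hj => ?_, h0⟩
        rcases hv.1 j hj with h | h
        · exact h
        · exact absurd (Or.inr ⟨hr, by rw [← h.2]; exact h.1⟩) hC
      obtain ⟨hv', hs⟩ := b_step r g hB
      obtain ⟨w, r', g', h1, h2, h3⟩ := ih (r + 1) g hv' (by
        rw [add_sub_cancel_right]
        have := val_pred r hr
        omega)
      exact ⟨Lt.b :: w, r', g', h1, h2, fun j => by simp [srun, hs, h3]⟩

theorem dm_rep (m : ℕ) : ∀ (p : ZMod k) (d : Fin 5),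
    srun (dm k) (List.replicate m Lt.b) (.inl (p, d)) = some (.inl (p - m, d)) := by
  induction m with
  | zero => simp [srun]
  | succ m ih =>
    intro p d
    simp only [List.replicate_succ, srun, dm, Option.bind_some, ih]
    push_cast; congr 3; ring

/-- the word that lets one token hop onto the next one -/
def hop (k : ℕ) : List Lt := [Lt.b, Lt.T] ++ (List.replicate (k - 1) Lt.b ++ [Lt.c, Lt.T])

theorem cast_ne (i : ℕ) (h1 : 1 ≤ i) (h2 : i < k) : (i : ZMod k) ≠ 0 := by
  intro h
  rw [ZMod.natCast_eq_zero_iff] at h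
  have := Nat.le_of_dvd h1 h
  omega

theorem hop_one : srun (dm k) (hop k) (.inl (1, 0)) = some (.inl (1, 0)) := by
  have hk : 1 < k := Fact.out
  have e : (0 : ZMod k) - ((k - 1 : ℕ) : ZMod k) = 1 := by
    rw [Nat.cast_sub hk.le]; simp
  simp only [hop, srun_append, srun, dm, Option.bind_some, sub_self, if_true, dm_rep, e,
    if_neg (one_ne_zero (α := ZMod k))]

theorem hop_succ (i : ℕ) (h1 : 1 ≤ i) (h2 : i + 1 < k) :
    srun (dm k) (hop k) (.inl (((i + 1 : ℕ) : ZMod k), 0)) = some (.inl ((i : ZMod k), 0)) := by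
  have hk : 1 < k := Fact.out
  have hi := cast_ne (k := k) i h1 (by omega)
  have hi' := cast_ne (k := k) (i + 1) (by omega) h2
  have e0 : ((i + 1 : ℕ) : ZMod k) - 1 = i := by push_cast; ring
  have e : (i : ZMod k) - ((k - 1 : ℕ) : ZMod k) = ((i + 1 : ℕ) : ZMod k) := by
    rw [Nat.cast_sub hk.le]; simp
  have hne : ((i + 1 : ℕ) : ZMod k) ≠ 1 := by
    intro h; apply hi; rw [← e0, h]; ring
  simp only [hop, srun_append, srun, dm, Option.bind_some, e0, if_neg hi, dm_rep, e,
    if_neg hi', if_neg hne]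

theorem hop_all (m : ℕ) (hm : m + 1 < k) :
    ∃ w, ∀ i : ℕ, 1 ≤ i → i ≤ m + 1 →
      srun (dm k) w (.inl ((i : ZMod k), 0)) = some (.inl (1, 0)) := by
  induction m with
  | zero =>
    refine ⟨[], fun i h1 h2 => ?_⟩
    obtain rfl : i = 1 := by omega
    simp [srun]
  | succ m ih =>
    obtain ⟨w, hw⟩ := ih (by omega)
    refine ⟨hop k ++ w, fun i h1 h2 => ?_⟩
    rw [srun_append]
    by_cases hi : i = 1
    · subst hi
      have := hw 1 le_rfl (by omega)
      rw [Nat.cast_one] at this ⊢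
      rw [hop_one, Option.bind_some, this]
    · obtain ⟨l, rfl⟩ : ∃ l, i = l + 1 := ⟨i - 1, by omega⟩
      rw [hop_succ l (by omega) (by omega), Option.bind_some]
      exact hw l (by omega) (by omega)

theorem T_all (q : QQ k) : ∃ j, dm k .T q = some (st 0 (fun _ => 0) j) := by
  have hz : (0 : ZMod k) ≠ -1 := by
    intro h; have : (1 : ZMod k) = 0 := by linear_combination h
    exact one_ne_zero this
  rcases q with ⟨p, d⟩ | (_ | _) | x
  · by_cases hp : p = 0
    · exact ⟨-1, by simp [dm, st, hp]⟩
    · refine ⟨p - 1, ?_⟩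
      have : p - 1 ≠ -1 := by
        intro h; apply hp; linear_combination h
      simp only [dm, st, if_neg hp, if_neg this]
      simp
  · exact ⟨-1, by simp [dm, st]⟩
  · exact ⟨0, by simp [dm, st, if_neg hz]⟩
  · exact ⟨-1, by simp [dm, st]⟩

theorem T_v (r : ZMod k) (g : ZMod k → ℕ) (hv : Valid r g) (h1 : g (-1) = 1) (j : ZMod k) :
    ∃ i : ℕ, 1 ≤ i ∧ i < k ∧ dm k .T (st r g j) = some (.inl ((i : ZMod k), 0)) := by
  have hk : 1 < k := Fact.out
  have : NeZero k := ⟨by omega⟩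
  have hr : r = 0 := by
    rcases hv.2 with h | h
    · omega
    · exact h.2
  subst hr
  by_cases hj : j = -1
  · exact ⟨1, le_rfl, hk, by simp [st, hj, h1, dm]⟩
  · have h4 : g j ≠ 4 := by
      intro h4
      rcases hv.1 j hj with h | h
      · omega
      · exact hj (by rw [h.2]; ring)
    have hp : j + 1 ≠ 0 := by
      intro h; apply hj; linear_combination h
    refine ⟨(j + 1).val, ?_, ZMod.val_lt _, ?_⟩
    · have := (ZMod.val_eq_zero (j + 1)).not.2 hp
      omega
    · simp [st, hj, h4, dm, hp]

end

theorem main_case (k : ℕ) (hk : 4 ≤ k) :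
    ∃ A : Finset (Fin (5 * k + 4) → Option (Fin (5 * k + 4))),
      A.card = 3 ∧
      (∃ w, CarefullySync A w) ∧
      (∀ w, CarefullySync A w → 4 ^ k ≤ w.length) := by
  have : Fact (1 < k) := ⟨by omega⟩
  have : NeZero k := ⟨by omega⟩
  have hv0 : Valid (0 : ZMod k) (fun _ => 0) := ⟨fun _ _ => Or.inl (Nat.zero_le _), Or.inl rfl⟩
  apply transfer (Q := QQ k) _ _ (by simp [ZMod.card]; ring) (dm k)
  · intro h
    have := congrFun h (.inr (.inl false))
    simp [dm] at this
  · intro h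
    have := congrFun h (.inr (.inl true))
    simp [dm] at this
  · intro h
    have := congrFun h (.inr (.inl false))
    simp [dm] at this
  · obtain ⟨w1, r, g, hv, h1, hw1⟩ := reach_v (k := k) _ 0 (fun _ => 0) hv0 (Nat.le_add_left _ _)
    obtain ⟨w2, hw2⟩ := hop_all (k := k) (k - 2) (by omega)
    refine ⟨Lt.T :: (w1 ++ (Lt.T :: w2)), .inl (1, 0), fun q => ?_⟩
    obtain ⟨j, hj⟩ := T_all q
    obtain ⟨i, hi1, hi2, hi⟩ := T_v r g hv h1 j
    simp only [srun, hj, Option.bind_some, srun_append, hw1, hi]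
    exact hw2 i hi1 (by omega)
  · intro w q₀ h
    have h1 := main_low w (0 : ZMod k) (fun _ => 0) q₀ hv0 (fun j => h _)
    rw [zero_sub, val_neg_one'] at h1
    simp only [VV, zero_mul, Finset.sum_const_zero, mul_zero] at h1
    have h2 : 4 * 4 ^ (k - 1) ≤ k * 4 ^ (k - 1) := Nat.mul_le_mul_right _ hk
    have h3 : 4 ^ k = 4 * 4 ^ (k - 1) := by
      rw [← pow_succ']; congr 1; omega
    omega

/-- For every `n ≥ 9` with `n ≡ 4 (mod 5)`, there is an alphabet of `3` partial
transformations of an `n`-element set admitting a carefully synchronising word, all of whose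
carefully synchronising words have length at least `4 ^ ((n - 4) / 5)`. -/
theorem car_lower_bound_ternary (n : ℕ) (hn : 9 ≤ n) (hmod : n % 5 = 4) :
    ∃ A : Finset (Fin n → Option (Fin n)),
      A.card = 3 ∧
      (∃ w, CarefullySync A w) ∧
      (∀ w, CarefullySync A w → 4 ^ ((n - 4) / 5) ≤ w.length) := by
  obtain ⟨k, rfl⟩ : ∃ k, n = 5 * k + 4 := ⟨n / 5, by omega⟩
  have hk : (5 * k + 4 - 4) / 5 = k := by omega
  rw [hk]
  by_cases h4 : 4 ≤ k
  · exact main_case k h4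
  · have : k = 1 ∨ k = 2 ∨ k = 3 := by omega
    rcases this with rfl | rfl | rfl
    · exact small_case _ _ 4 5 (by norm_num) (by norm_num) (by norm_num) (by norm_num) (by norm_num)
    · exact small_case _ _ 5 9 (by norm_num) (by norm_num) (by norm_num) (by norm_num) (by norm_num)
    · exact small_case _ _ 9 10 (by norm_num) (by norm_num) (by norm_num) (by norm_num) (by norm_num)
end

section
/- For every natural number n ≥ 7 with n ≡ 3 (mod 4), there exists a set A of 3 partial transformations of an n-element set such that A admits a carefully synchronising word, and every carefully synchronising word for A has length at least 3^((n−3)/4). -/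
namespace TernaryCounter

/-- States: `inl (i, v)` is cell `i` holding the symbol `v` (`3` is the end marker),
`inr 0` is the starred digit `2` in the last cell; `inr 1`, `inr 2` are dummies. -/
abbrev St (m : ℕ) : Type := (ZMod (m + 1) × Fin 4) ⊕ Fin 3

/-- The three letters: `0` resets, `1` rotates, `2` rotates and decrements. -/
def step {m : ℕ} (l : Fin 3) (s : St m) : Option (St m) :=
  if l = 0 then
    match s with
    | Sum.inl (i, _) => if i = 0 then some (Sum.inl (0, 3)) else some (Sum.inl (i, 2))
    | Sum.inr _ => some (Sum.inl (-1, 2))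
  else if l = 1 then
    match s with
    | Sum.inl (i, v) => some (Sum.inl (i - 1, v))
    | Sum.inr _ => some (Sum.inl (-2, 2))
  else
    match s with
    | Sum.inl (i, v) =>
        if i = 0 then
          (if v = 0 then some (Sum.inr 0)
            else if v = 3 then some (Sum.inl (0, 3)) else some (Sum.inl (-1, v - 1)))
        else if i = -1 ∧ v ≠ 3 then none
        else some (Sum.inl (i - 1, v))
    | Sum.inr _ => some (Sum.inl (-2, 2))

def run {m : ℕ} : List (Fin 3) → St m → Option (St m)
  | [], s => some s
  | l :: w, s => (step l s).bind (run w)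

def SyncOn {m : ℕ} (w : List (Fin 3)) (S : Set (St m)) : Prop :=
  ∃ q₀, ∀ s ∈ S, run w s = some q₀

open Classical in
/-- Token `j` of the configuration. -/
noncomputable def pos {m : ℕ} (t : ℕ) (d : ZMod (m + 1) → Fin 4) (st : Prop)
    (j : ZMod (m + 1)) : St m :=
  if st ∧ j + 1 = (t : ZMod (m + 1)) then Sum.inr 0 else Sum.inl (j - t, d j)

def conf {m : ℕ} (t : ℕ) (d : ZMod (m + 1) → Fin 4) (st : Prop) : Set (St m) :=
  Set.range (pos t d st)

def val {m : ℕ} (d : ZMod (m + 1) → Fin 4) : ℤ :=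
  ∑ j ∈ Finset.range m, ((d (j : ZMod (m + 1))).val : ℤ) * 3 ^ j

structure Inv {m : ℕ} (t : ℕ) (d : ZMod (m + 1) → Fin 4) (st : Prop) : Prop where
  ht : t ≤ m
  hd : ∀ j < m, d (j : ZMod (m + 1)) ≠ 3
  hm : d (m : ZMod (m + 1)) = 3
  hs : st → 1 ≤ t ∧ ∀ j < t, d (j : ZMod (m + 1)) = 2

open Classical in
noncomputable def pot {m : ℕ} (t : ℕ) (d : ZMod (m + 1) → Fin 4) (st : Prop) : ℤ :=
  if st then (m + 1) * (val d + 2 - 3 ^ t) - t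
  else if t = 0 then (m + 1) * (val d + 1)
  else (m + 1) * (val d + 1) + (m + 1) - t

def d0 (m : ℕ) : ZMod (m + 1) → Fin 4 := fun j => if j = (m : ZMod (m + 1)) then 3 else 2

lemma cast_inj {m a b : ℕ} (ha : a ≤ m) (hb : b ≤ m) :
    ((a : ZMod (m + 1)) = b) ↔ a = b := by
  rw [ZMod.natCast_eq_natCast_iff', Nat.mod_eq_of_lt (by omega), Nat.mod_eq_of_lt (by omega)]

lemma cast_m {m : ℕ} : (m : ZMod (m + 1)) = -1 := by
  have : ((m + 1 : ℕ) : ZMod (m + 1)) = 0 := ZMod.natCast_self _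
  push_cast at this
  exact eq_neg_of_add_eq_zero_left this

lemma exists_cast {m : ℕ} (j : ZMod (m + 1)) : ∃ a : ℕ, a ≤ m ∧ j = a :=
  ⟨j.val, Nat.lt_succ_iff.mp (ZMod.val_lt j), (ZMod.natCast_zmod_val j).symm⟩

lemma one_ne {m : ℕ} (hm : 2 ≤ m) : (1 : ZMod (m + 1)) ≠ 0 := by
  have := (cast_inj (m := m) (a := 1) (b := 0) (by omega) (by omega))
  simpa using this

lemma two_ne {m : ℕ} (hm : 2 ≤ m) : (2 : ZMod (m + 1)) ≠ 0 := by
  have := (cast_inj (m := m) (a := 2) (b := 0) (by omega) (by omega))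
  simpa using this

lemma Inv.ne3 {m t : ℕ} {d : ZMod (m + 1) → Fin 4} {st : Prop} (h : Inv t d st)
    {j : ZMod (m + 1)} (hj : j ≠ -1) : d j ≠ 3 := by
  obtain ⟨a, ha, rfl⟩ := exists_cast j
  apply h.hd
  rcases Nat.lt_or_eq_of_le ha with h | rfl
  · exact h
  · exact absurd cast_m hj

lemma sum_two (t : ℕ) : ∑ j ∈ Finset.range t, (2 : ℤ) * 3 ^ j = 3 ^ t - 1 := by
  induction t with
  | zero => simp
  | succ n ih => rw [Finset.sum_range_succ, ih]; ring

lemma val_ge {m t : ℕ} (ht : t ≤ m) (d : ZMod (m + 1) → Fin 4)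
    (h : ∀ j < t, d (j : ZMod (m + 1)) = 2) : (3 : ℤ) ^ t - 1 ≤ val d := by
  rw [← sum_two, val]
  calc ∑ j ∈ Finset.range t, (2 : ℤ) * 3 ^ j
      = ∑ j ∈ Finset.range t, ((d (j : ZMod (m + 1))).val : ℤ) * 3 ^ j := by
        apply Finset.sum_congr rfl
        intro j hj
        rw [h j (Finset.mem_range.mp hj)]; rfl
    _ ≤ _ := by
        apply Finset.sum_le_sum_of_subset_of_nonneg
        · intro x; simp only [Finset.mem_range]; omega
        · intros; positivity

lemma val_eq {m : ℕ} (d : ZMod (m + 1) → Fin 4)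
    (h : ∀ j < m, d (j : ZMod (m + 1)) = 2) : val d = 3 ^ m - 1 := by
  rw [← sum_two, val]
  apply Finset.sum_congr rfl
  intro j hj
  rw [h j (Finset.mem_range.mp hj)]; rfl

lemma val_nonneg {m : ℕ} (d : ZMod (m + 1) → Fin 4) : 0 ≤ val d :=
  Finset.sum_nonneg (fun _ _ => by positivity)

lemma val_update {m t : ℕ} (ht : t < m) (d : ZMod (m + 1) → Fin 4) (x : Fin 4) :
    val (Function.update d (t : ZMod (m + 1)) x)
      = val d + ((x.val : ℤ) - ((d t).val : ℤ)) * 3 ^ t := by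
  have htm : t ∈ Finset.range m := Finset.mem_range.mpr ht
  rw [val, val, ← Finset.add_sum_erase _ _ htm, ← Finset.add_sum_erase _ _ htm]
  have : ∑ j ∈ (Finset.range m).erase t,
        (((Function.update d (t : ZMod (m + 1)) x) (j : ZMod (m + 1))).val : ℤ) * 3 ^ j
      = ∑ j ∈ (Finset.range m).erase t, ((d (j : ZMod (m + 1))).val : ℤ) * 3 ^ j := by
    apply Finset.sum_congr rfl
    intro j hj
    simp only [Finset.mem_erase, Finset.mem_range] at hj
    rw [Function.update_of_ne]
    rw [Ne, cast_inj (by omega) (by omega)]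
    exact hj.1
  rw [this]
  simp only [Function.update_self]
  ring

/-- New digit after a decrement. -/
def dec (x : Fin 4) : Fin 4 := if x = 0 then 2 else x - 1

lemma syncOn_cons {m : ℕ} {w : List (Fin 3)} {l : Fin 3} {S T : Set (St m)}
    (h : SyncOn w T) (hST : ∀ s ∈ S, ∃ s' ∈ T, step l s = some s') : SyncOn (l :: w) S := by
  obtain ⟨q, hq⟩ := h
  refine ⟨q, fun s hs => ?_⟩
  obtain ⟨s', hs', he⟩ := hST s hs
  simp [run, he, hq s' hs']

lemma syncOn_of_cons {m : ℕ} {w : List (Fin 3)} {l : Fin 3} {S T : Set (St m)}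
    (h : SyncOn (l :: w) S) (hST : ∀ s' ∈ T, ∃ s ∈ S, step l s = some s') : SyncOn w T := by
  obtain ⟨q, hq⟩ := h
  refine ⟨q, fun s' hs' => ?_⟩
  obtain ⟨s, hs, he⟩ := hST s' hs'
  have := hq s hs
  simpa [run, he] using this

lemma iff_of_pos {m : ℕ} {w : List (Fin 3)} {l : Fin 3} {t t' : ℕ}
    {d d' : ZMod (m + 1) → Fin 4} {st st' : Prop}
    (h : ∀ j, step l (pos t d st j) = some (pos t' d' st' j)) :
    SyncOn (l :: w) (conf t d st) ↔ SyncOn w (conf t' d' st') := by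
  constructor
  · intro hw
    apply syncOn_of_cons hw
    rintro _ ⟨j, rfl⟩
    exact ⟨_, ⟨j, rfl⟩, h j⟩
  · intro hw
    apply syncOn_cons hw
    rintro _ ⟨j, rfl⟩
    exact ⟨_, ⟨j, rfl⟩, h j⟩

lemma step_b {m t : ℕ} {d : ZMod (m + 1) → Fin 4} {st : Prop} (h : Inv t d st)
    (j : ZMod (m + 1)) :
    step 1 (pos t d st j) = some (pos (if t = m then 0 else t + 1) d False j) := by
  have ht' : (((if t = m then 0 else t + 1 : ℕ)) : ZMod (m + 1)) = t + 1 := by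
    split_ifs with h1
    · subst h1; rw [cast_m]; simp
    · push_cast; rfl
  unfold pos
  rw [ht']
  by_cases hs : st ∧ j + 1 = (t : ZMod (m + 1))
  · rw [if_pos hs]
    have hst := h.hs hs.1
    have hj : j = ((t - 1 : ℕ) : ZMod (m + 1)) := by
      rw [Nat.cast_sub hst.1, ← hs.2]; simp
    have hd := hst.2 (t - 1) (by omega)
    rw [← hj] at hd
    simp only [step, false_and, if_false, hd, ← hs.2]
    simp
    ring
  · rw [if_neg hs]
    simp [step]
    ring

lemma step_c {m t : ℕ} (hm2 : 2 ≤ m) {d : ZMod (m + 1) → Fin 4} {st : Prop} (h : Inv t d st)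
    (htm : t < m) (hok : t = 0 ∨ st) (j : ZMod (m + 1)) :
    step 2 (pos t d st j)
      = some (pos (t + 1) (Function.update d t (dec (d t))) (d t = 0) j) := by
  have h1 := one_ne hm2
  unfold pos
  push_cast
  by_cases hjt : j = t
  · subst hjt
    have h3 : d t ≠ 3 := h.hd t htm
    have : ¬ (st ∧ (t : ZMod (m + 1)) + 1 = t) := by
      rintro ⟨_, h⟩; exact h1 (by simpa using h)
    rw [if_neg this]
    by_cases h0 : d t = 0
    · simp [step, h0]
    · simp [step, h0, h3, dec]
  · have hjt' : j - (t : ZMod (m + 1)) ≠ 0 := sub_ne_zero.mpr hjt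
    have hc : ¬ (d t = 0 ∧ j + 1 = (t : ZMod (m + 1)) + 1) := by
      rintro ⟨_, h⟩; exact hjt (by simpa using h)
    rw [if_neg hc, Function.update_of_ne hjt]
    by_cases hs : st ∧ j + 1 = (t : ZMod (m + 1))
    · rw [if_pos hs]
      have hst := h.hs hs.1
      have hj : j = ((t - 1 : ℕ) : ZMod (m + 1)) := by
        rw [Nat.cast_sub hst.1, ← hs.2]; simp
      have hd := hst.2 (t - 1) (by omega)
      rw [← hj] at hd
      simp only [step, hd, ← hs.2]
      simp
      ring
    · rw [if_neg hs]
      have : ¬ (j - (t : ZMod (m + 1)) = -1 ∧ d j ≠ 3) := by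
        rintro ⟨ha, hb⟩
        have ha' : j + 1 = (t : ZMod (m + 1)) := by linear_combination ha
        rcases hok with rfl | hst
        · apply hb
          have : j = (m : ZMod (m + 1)) := by rw [cast_m]; simpa using ha
          rw [this, h.hm]
        · exact hs ⟨hst, ha'⟩
      simp only [step]
      rw [if_neg (by decide), if_neg (by decide), if_neg hjt', if_neg this]
      congr 3
      ring

lemma no_c {m t : ℕ} (hm2 : 2 ≤ m) {d : ZMod (m + 1) → Fin 4} {st : Prop} (h : Inv t d st)
    (ht : t ≠ 0) (hst : ¬ st) (w : List (Fin 3)) : ¬ SyncOn (2 :: w) (conf t d st) := by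
  rintro ⟨q, hq⟩
  have := hq _ ⟨((t - 1 : ℕ) : ZMod (m + 1)), rfl⟩
  have hlt := h.ht
  have h3 := h.hd (t - 1) (by omega)
  have hc : ((t - 1 : ℕ) : ZMod (m + 1)) - t = -1 := by
    rw [Nat.cast_sub (by omega)]; simp
  simp only [run, pos, hst, false_and, if_false, hc, step] at this
  simp [one_ne hm2, h3] at this

lemma step_r {m t : ℕ} (hm2 : 2 ≤ m) {d : ZMod (m + 1) → Fin 4} {st : Prop}
    (j : ZMod (m + 1)) :
    step 0 (pos t d st (j + t + 1)) = some (pos m (d0 m) False j) := by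
  have h1 := one_ne hm2
  unfold pos
  rw [cast_m]
  by_cases hs : st ∧ j + t + 1 + 1 = (t : ZMod (m + 1))
  · rw [if_pos hs]
    have : j = -2 := by linear_combination hs.2
    subst this
    have h2 : (-2 : ZMod (m + 1)) ≠ -1 := by
      intro h; apply h1; linear_combination -h
    simp [step, d0, cast_m, h2]
    ring
  · rw [if_neg hs]
    have e : j + t + 1 - (t : ZMod (m + 1)) = j + 1 := by ring
    rw [e]
    by_cases hj : j = -1
    · subst hj
      simp [step, d0, cast_m]
    · have : j + 1 ≠ 0 := fun h => hj (eq_neg_of_add_eq_zero_left h)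
      simp [step, d0, cast_m, hj, this]

lemma inv_d0 (m : ℕ) : Inv m (d0 m) False where
  ht := le_rfl
  hd := by
    intro j hj
    simp [d0, cast_inj hj.le le_rfl, hj.ne]
  hm := by simp [d0]
  hs := fun h => h.elim

lemma inv_b {m t : ℕ} {d : ZMod (m + 1) → Fin 4} {st : Prop} (h : Inv t d st) :
    Inv (if t = m then 0 else t + 1) d False where
  ht := by have := h.ht; split_ifs <;> omega
  hd := h.hd
  hm := h.hm
  hs := fun h => h.elim

lemma dec_ne {x : Fin 4} (h : x ≠ 3) : dec x ≠ 3 := by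
  revert x; decide

lemma inv_c {m t : ℕ} {d : ZMod (m + 1) → Fin 4} {st : Prop} (h : Inv t d st)
    (htm : t < m) (hok : t = 0 ∨ st) :
    Inv (t + 1) (Function.update d t (dec (d t))) (d t = 0) where
  ht := htm
  hd := by
    intro j hj
    by_cases e : j = t
    · subst e; rw [Function.update_self]; exact dec_ne (h.hd _ hj)
    · rw [Function.update_of_ne]
      · exact h.hd j hj
      · rwa [Ne, cast_inj (by omega) (by omega)]
  hm := by
    rw [Function.update_of_ne]
    · exact h.hm
    · rw [Ne, cast_inj (by omega) (by omega)]; omega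
  hs := by
    intro h0
    refine ⟨by omega, fun j hj => ?_⟩
    by_cases e : j = t
    · subst e; rw [Function.update_self, h0]; rfl
    · rw [Function.update_of_ne]
      · rcases hok with rfl | hst
        · omega
        · exact (h.hs hst).2 j (by omega)
      · rwa [Ne, cast_inj (by omega) (by omega)]

lemma pot_c {m t : ℕ} {d : ZMod (m + 1) → Fin 4} {st : Prop} (h : Inv t d st)
    (htm : t < m) (hok : t = 0 ∨ st) :
    pot (t + 1) (Function.update d t (dec (d t))) (d t = 0) = pot t d st - 1 := by
  have h3 := h.hd t htm
  have hpot : pot t d st = (m + 1) * (val d + 2 - 3 ^ t) - t := by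
    unfold pot
    by_cases hst : st
    · rw [if_pos hst]
    · rcases hok with rfl | h'
      · rw [if_neg hst]; simp; left; ring
      · exact absurd h' hst
  rw [hpot, pot, val_update htm]
  by_cases h0 : d t = 0
  · rw [if_pos h0, h0]
    have : ((dec 0).val : ℤ) = 2 := rfl
    rw [this]
    simp only [Fin.val_zero]
    push_cast
    ring
  · rw [if_neg h0, if_neg (by omega)]
    have : ∀ x : Fin 4, x ≠ 0 → ((dec x).val : ℤ) - x.val = -1 := by decide
    rw [this _ h0]
    push_cast
    ring

lemma pot_b_le {m t : ℕ} {d : ZMod (m + 1) → Fin 4} {st : Prop} (h : Inv t d st) :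
    pot t d st - 1 ≤ pot (if t = m then 0 else t + 1) d False := by
  have hlt := h.ht
  have h3 : (1 : ℤ) ≤ 3 ^ t := one_le_pow₀ (by norm_num)
  have hmul : ((m : ℤ) + 1) * 1 ≤ (m + 1) * 3 ^ t :=
    mul_le_mul_of_nonneg_left h3 (by positivity)
  have hlt' : (t : ℤ) ≤ m := by exact_mod_cast hlt
  unfold pot
  simp only [if_false]
  split_ifs with h1 h2 h4 h5 h6 h7 h8 <;> first | omega | contradiction | (push_cast; nlinarith)

lemma pot_b_eq {m t : ℕ} {d : ZMod (m + 1) → Fin 4} {st : Prop} (h : Inv t d st)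
    (ht : t ≠ 0) (hst : ¬ st) :
    pot (if t = m then 0 else t + 1) d False = pot t d st - 1 := by
  unfold pot
  simp only [if_false, hst, ht]
  split_ifs with h1 h2 h3
  · subst h1; ring
  all_goals first | omega | contradiction | (push_cast; ring)

lemma pot_pos {m t : ℕ} {d : ZMod (m + 1) → Fin 4} {st : Prop} (h : Inv t d st) :
    1 ≤ pot t d st := by
  have hv := val_nonneg d
  have hlt' : (t : ℤ) ≤ m := by exact_mod_cast h.ht
  unfold pot
  split_ifs with h1
  · have := val_ge h.ht d (h.hs h1).2
    nlinarith
  · nlinarith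
  · nlinarith

theorem lower {m : ℕ} (hm2 : 2 ≤ m) (w : List (Fin 3)) :
    ∀ (t : ℕ) (d : ZMod (m + 1) → Fin 4) (st : Prop), Inv t d st → SyncOn w (conf t d st) →
      pot t d st ≤ w.length ∨ ((m : ℤ) + 1) * 3 ^ m ≤ w.length := by
  induction w with
  | nil =>
    intro t d st h ⟨q, hq⟩
    exfalso
    have h1 := one_ne hm2
    have h2 := two_ne hm2
    have a := hq _ ⟨(t : ZMod (m + 1)), rfl⟩
    have b := hq _ ⟨(t : ZMod (m + 1)) + 1, rfl⟩
    have e : (t : ZMod (m + 1)) + 1 + 1 ≠ t := by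
      intro h; apply h2; linear_combination h
    simp only [run] at a b
    rw [← b] at a
    simp [pos, h1, e, h1.symm] at a
  | cons l w ih =>
    intro t d st h hw
    have hl : l = 0 ∨ l = 1 ∨ l = 2 := by clear hw; revert l; decide
    simp only [List.length_cons]
    push_cast
    rcases hl with rfl | rfl | rfl
    · right
      have : SyncOn w (conf m (d0 m) False) := by
        apply syncOn_of_cons hw
        rintro _ ⟨j, rfl⟩
        exact ⟨_, ⟨j + t + 1, rfl⟩, step_r hm2 j⟩
      have hv : val (d0 m) = 3 ^ m - 1 := by
        apply val_eq
        intro j hj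
        simp [d0, cast_inj hj.le le_rfl, hj.ne]
      rcases ih _ _ _ (inv_d0 m) this with h' | h'
      · rw [pot, if_neg not_false, if_neg (by omega), hv] at h'
        linarith
      · linarith
    · have := (iff_of_pos (step_b h)).mp hw
      have hp := pot_b_le h
      rcases ih _ _ _ (inv_b h) this with h' | h'
      · left; linarith
      · right; linarith
    · by_cases hok : t = 0 ∨ st
      · rcases Nat.lt_or_eq_of_le h.ht with htm | rfl
        · have := (iff_of_pos (step_c hm2 h htm hok)).mp hw
          have hp := pot_c h htm hok
          rcases ih _ _ _ (inv_c h htm hok) this with h' | h'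
          · left; linarith
          · right; linarith
        · left
          have hst : st := by
            rcases hok with h | h
            · omega
            · exact h
          rw [pot, if_pos hst, val_eq d (h.hs hst).2]
          have : (0 : ℤ) ≤ w.length := by positivity
          nlinarith
      · push Not at hok
        exact absurd hw (no_c hm2 h hok.1 hok.2 w)

def fin_set (m s : ℕ) : Set (St m) :=
  {x | x = Sum.inl (0, 3) ∨ ∃ a : ℕ, 1 ≤ a ∧ a ≤ s ∧ x = Sum.inl ((a : ZMod (m + 1)), 2)}

lemma r_fin {m s a : ℕ} (hs : s ≤ m) (ha : a ≤ s) :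
    ∃ s' ∈ fin_set m s, step 0 (Sum.inl ((a : ZMod (m + 1)), 2)) = some s' := by
  by_cases h : a = 0
  · subst h
    exact ⟨_, Or.inl rfl, by simp [step]⟩
  · refine ⟨_, Or.inr ⟨a, by omega, ha, rfl⟩, ?_⟩
    have : (a : ZMod (m + 1)) ≠ 0 := by
      have := cast_inj (m := m) (a := a) (b := 0) (by omega) (by omega)
      rw [Nat.cast_zero] at this
      rwa [Ne, this]
    simp [step, this]

/-- Intermediate sets: the marker in cell `0` together with cells `0..s` holding `2`. -/
def mid_set (m s : ℕ) : Set (St m) :=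
  {x | x = Sum.inl (0, 3) ∨ ∃ a : ℕ, a ≤ s ∧ x = Sum.inl ((a : ZMod (m + 1)), 2)}

lemma mid_sync {m s : ℕ} (hs : s ≤ m) {w : List (Fin 3)} (h : SyncOn w (fin_set m s)) :
    SyncOn (0 :: w) (mid_set m s) := by
  apply syncOn_cons h
  rintro x (rfl | ⟨a, ha, rfl⟩)
  · exact ⟨_, Or.inl rfl, by simp [step]⟩
  · exact r_fin hs ha

lemma c_mid {m a : ℕ} (ha : a + 1 < m) :
    step 2 (Sum.inl (((a + 1 : ℕ) : ZMod (m + 1)), 2)) = some (Sum.inl ((a : ZMod (m + 1)), 2)) := by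
  have h0 : ((a + 1 : ℕ) : ZMod (m + 1)) ≠ 0 := by
    have := cast_inj (m := m) (a := a + 1) (b := 0) (by omega) (by omega)
    rw [Nat.cast_zero] at this
    rw [Ne, this]; omega
  have h1 : ((a + 1 : ℕ) : ZMod (m + 1)) ≠ -1 := by
    rw [← cast_m, Ne, cast_inj (by omega) (by omega)]; omega
  simp only [step]
  rw [if_neg (by decide), if_neg (by decide), if_neg h0, if_neg (fun h => h1 h.1)]
  simp

lemma fin_sync {m : ℕ} (s : ℕ) (hs : s < m) : ∃ w, SyncOn w (fin_set m s) := by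
  induction s with
  | zero =>
    refine ⟨[], Sum.inl (0, 3), ?_⟩
    rintro x (rfl | ⟨a, h1, h2, _⟩)
    · rfl
    · omega
  | succ s ih =>
    obtain ⟨w, hw⟩ := ih (by omega)
    refine ⟨2 :: 0 :: w, syncOn_cons (mid_sync (by omega) hw) ?_⟩
    rintro x (rfl | ⟨a, h1, h2, rfl⟩)
    · exact ⟨_, Or.inl rfl, by simp [step]⟩
    · obtain ⟨b, rfl⟩ : ∃ b, a = b + 1 := ⟨a - 1, by omega⟩
      exact ⟨_, Or.inr ⟨b, by omega, rfl⟩, c_mid (by omega)⟩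

lemma gate {m : ℕ} (hm2 : 2 ≤ m) {d : ZMod (m + 1) → Fin 4} {st : Prop} (h : Inv m d st)
    (hst : st) : ∃ w, SyncOn w (conf m d st) := by
  obtain ⟨w, hw⟩ := fin_sync (m := m) (m - 1) (by omega)
  refine ⟨2 :: 0 :: w, syncOn_cons (mid_sync (by omega) hw) ?_⟩
  rintro _ ⟨j, rfl⟩
  unfold pos
  by_cases hs : st ∧ j + 1 = (m : ZMod (m + 1))
  · rw [if_pos hs]
    refine ⟨_, Or.inr ⟨m - 1, le_rfl, rfl⟩, ?_⟩
    rw [Nat.cast_sub (by omega), cast_m]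
    simp [step]
    ring
  · rw [if_neg hs]
    obtain ⟨a, ha, rfl⟩ := exists_cast j
    rcases Nat.lt_or_eq_of_le ha with ha | rfl
    · have ha' : a + 1 ≠ m := by
        intro e
        apply hs
        refine ⟨hst, ?_⟩
        rw [← e]; push_cast; rfl
      have e : (a : ZMod (m + 1)) - m = ((a + 1 : ℕ) : ZMod (m + 1)) := by
        rw [cast_m]; push_cast; ring
      rw [e, (h.hs hst).2 a ha]
      exact ⟨_, Or.inr ⟨a, by omega, rfl⟩, c_mid (by omega)⟩
    · rw [h.hm]
      exact ⟨_, Or.inl rfl, by simp [step]⟩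

theorem upper {m : ℕ} (hm2 : 2 ≤ m) (N : ℕ) :
    ∀ (t : ℕ) (d : ZMod (m + 1) → Fin 4) (st : Prop), Inv t d st → pot t d st ≤ N →
      ∃ w, SyncOn w (conf t d st) := by
  induction N with
  | zero =>
    intro t d st h hp
    have := pot_pos h
    push_cast at hp
    linarith
  | succ N ih =>
    intro t d st h hp
    push_cast at hp
    by_cases hok : t = 0 ∨ st
    · rcases Nat.lt_or_eq_of_le h.ht with htm | rfl
      · obtain ⟨w, hw⟩ := ih _ _ _ (inv_c h htm hok) (by rw [pot_c h htm hok]; linarith)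
        exact ⟨2 :: w, (iff_of_pos (step_c hm2 h htm hok)).mpr hw⟩
      · apply gate hm2 h
        rcases hok with h | h
        · omega
        · exact h
    · push Not at hok
      obtain ⟨w, hw⟩ := ih _ _ _ (inv_b h) (by rw [pot_b_eq h hok.1 hok.2]; linarith)
      exact ⟨1 :: w, (iff_of_pos (step_b h)).mpr hw⟩

theorem upper_univ {m : ℕ} (hm2 : 2 ≤ m) : ∃ w, SyncOn w (Set.univ : Set (St m)) := by
  obtain ⟨w, hw⟩ := upper hm2 (pot m (d0 m) False).toNat m (d0 m) False (inv_d0 m)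
    (Int.self_le_toNat _)
  refine ⟨0 :: w, syncOn_cons hw ?_⟩
  have h1 := one_ne hm2
  rintro (⟨i, v⟩ | x) -
  · refine ⟨_, ⟨i - 1, rfl⟩, ?_⟩
    by_cases hi : i = 0
    · subst hi; simp [step, pos, d0, cast_m]
    · simp [step, pos, d0, cast_m, hi]
  · refine ⟨_, ⟨-2, rfl⟩, ?_⟩
    have h2 : (-2 : ZMod (m + 1)) ≠ -1 := by
      intro h; apply h1; linear_combination -h
    simp [step, pos, d0, cast_m, h2]
    ring

theorem lower_univ {m : ℕ} (hm2 : 2 ≤ m) (w : List (Fin 3))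
    (hw : SyncOn w (Set.univ : Set (St m))) : 3 ^ (m + 1) ≤ w.length := by
  have hc : SyncOn w (conf m (d0 m) False) := by
    obtain ⟨q, hq⟩ := hw
    exact ⟨q, fun s _ => hq s trivial⟩
  have hv : val (d0 m) = 3 ^ m - 1 := by
    apply val_eq
    intro j hj
    simp [d0, cast_inj hj.le le_rfl, hj.ne]
  have key : ((m : ℤ) + 1) * 3 ^ m ≤ w.length := by
    rcases lower hm2 w _ _ _ (inv_d0 m) hc with h' | h'
    · rw [pot, if_neg not_false, if_neg (by omega), hv] at h'
      linarith
    · exact h'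
  have key' : (m + 1) * 3 ^ m ≤ w.length := by exact_mod_cast key
  calc 3 ^ (m + 1) = 3 * 3 ^ m := by ring
    _ ≤ (m + 1) * 3 ^ m := Nat.mul_le_mul_right _ (by omega)
    _ ≤ _ := key'

lemma step_inj {m : ℕ} (hm2 : 2 ≤ m) : Function.Injective (step (m := m)) := by
  have h1 := one_ne hm2
  intro a b hab
  have e1 := congrFun hab (Sum.inl (0, 3))
  have e2 := congrFun hab (Sum.inl (-1, 2))
  have ha : a = 0 ∨ a = 1 ∨ a = 2 := by clear hab e1 e2; revert a; decide
  have hb : b = 0 ∨ b = 1 ∨ b = 2 := by clear hab e1 e2 ha; revert b; decide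
  rcases ha with rfl | rfl | rfl <;> rcases hb with rfl | rfl | rfl <;>
    simp [step, h1] at e1 e2 ⊢

section transfer
variable {m n : ℕ} (e : St m ≃ Fin n)

def letter (l : Fin 3) : Fin n → Option (Fin n) := fun q => (step l (e.symm q)).map e

lemma letter_inj (hm2 : 2 ≤ m) : Function.Injective (letter e) := by
  intro a b hab
  apply step_inj hm2
  funext s
  have := congrFun hab (e s)
  simp only [letter, Equiv.symm_apply_apply] at this
  exact Option.map_injective e.injective this

lemma foldl_none {n : ℕ} (w : List (Fin n → Option (Fin n))) :
    w.foldl (fun o f => o.bind f) none = none := by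
  induction w with
  | nil => rfl
  | cons a w ih => simpa using ih

lemma pt_run (w : List (Fin 3)) (s : St m) :
    ptApply (w.map (letter e)) (e s) = (run w s).map e := by
  induction w generalizing s with
  | nil => rfl
  | cons l w ih =>
    simp only [ptApply, List.map_cons, List.foldl_cons, run, Option.bind_some, letter,
      Equiv.symm_apply_apply]
    cases hs : step l s with
    | none => simp [foldl_none]
    | some s' => simpa [ptApply, letter] using ih s'

lemma exists_word (w : List (Fin n → Option (Fin n)))
    (h : ∀ g ∈ w, g ∈ Finset.univ.image (letter e)) : ∃ v : List (Fin 3), w = v.map (letter e) := by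
  induction w with
  | nil => exact ⟨[], rfl⟩
  | cons g w ih =>
    obtain ⟨v, rfl⟩ := ih (fun g hg => h g (List.mem_cons_of_mem _ hg))
    obtain ⟨l, -, rfl⟩ := Finset.mem_image.mp (h g List.mem_cons_self)
    exact ⟨l :: v, rfl⟩

end transfer

theorem big (m n : ℕ) (hm2 : 2 ≤ m) (hn : n = 4 * (m + 1) + 3) :
    ∃ A : Finset (Fin n → Option (Fin n)),
      A.card = 3 ∧ (∃ w, CarefullySync A w) ∧
      (∀ w, CarefullySync A w → 3 ^ (m + 1) ≤ w.length) := by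
  have hcard : Fintype.card (St m) = Fintype.card (Fin n) := by
    simp [ZMod.card]; omega
  have e : St m ≃ Fin n := Fintype.equivOfCardEq hcard
  refine ⟨Finset.univ.image (letter e), ?_, ?_, ?_⟩
  · rw [Finset.card_image_of_injective _ (letter_inj e hm2)]; simp
  · obtain ⟨w, q, hq⟩ := upper_univ hm2
    refine ⟨w.map (letter e), ?_, e q, ?_⟩
    · intro g hg
      obtain ⟨l, -, rfl⟩ := List.mem_map.mp hg
      exact Finset.mem_image_of_mem _ (Finset.mem_univ _)
    · intro x
      obtain ⟨s, rfl⟩ := e.surjective x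
      rw [pt_run, hq s trivial]; rfl
  · rintro w ⟨hA, q, hq⟩
    obtain ⟨v, rfl⟩ := exists_word e w hA
    rw [List.length_map]
    apply lower_univ hm2
    refine ⟨e.symm q, fun s _ => ?_⟩
    have := hq (e s)
    rw [pt_run] at this
    apply Option.map_injective e.injective
    rw [this]; simp

/-- Small cases: the letters shift down by one, identity, nowhere defined. -/
theorem small (n : ℕ) (hn : 7 ≤ n) :
    ∃ A : Finset (Fin n → Option (Fin n)),
      A.card = 3 ∧ (∃ w, CarefullySync A w) ∧
      (∀ w, CarefullySync A w → n - 1 ≤ w.length) := by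
  let a : Fin n → Option (Fin n) := fun q => some ⟨q.val - 1, by omega⟩
  let b : Fin n → Option (Fin n) := fun q => some q
  let c : Fin n → Option (Fin n) := fun _ => none
  have hab : a ≠ b := by
    intro h
    have := congrFun h ⟨1, by omega⟩
    simp [a, b] at this
  have hac : a ≠ c := by
    intro h
    have := congrFun h ⟨1, by omega⟩
    simp [a, c] at this
  have hbc : b ≠ c := by
    intro h
    have := congrFun h ⟨1, by omega⟩
    simp [b, c] at this
  refine ⟨{a, b, c}, Finset.card_eq_three.mpr ⟨a, b, c, hab, hac, hbc, rfl⟩, ?_, ?_⟩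
  · have key : ∀ N : ℕ, ∀ q : Fin n,
        ptApply (List.replicate N a) q = some ⟨q.val - N, by omega⟩ := by
      intro N
      induction N with
      | zero => intro q; simp [ptApply]
      | succ N ih =>
        intro q
        have := ih ⟨q.val - 1, by omega⟩
        simp only [ptApply, List.replicate_succ, List.foldl_cons, Option.bind_some] at this ⊢
        rw [show a q = some ⟨q.val - 1, by omega⟩ from rfl, this]
        simp only [Option.some.injEq, Fin.mk.injEq]
        omega
    refine ⟨List.replicate n a, ?_, ⟨0, by omega⟩, ?_⟩
    · intro g hg
      rw [List.eq_of_mem_replicate hg]; simp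
    · intro q
      rw [key]
      simp only [Option.some.injEq, Fin.mk.injEq]
      omega
  · have key : ∀ w : List (Fin n → Option (Fin n)), (∀ g ∈ w, g ∈ ({a, b, c} : Finset _)) →
        ∀ q r : Fin n, ptApply w q = some r → q.val ≤ r.val + w.length ∧ r.val ≤ q.val := by
      intro w
      induction w with
      | nil =>
        intro _ q r h
        simp only [ptApply, List.foldl_nil, Option.some.injEq] at h
        subst h; simp
      | cons g w ih =>
        intro hA q r h
        have ih' := ih (fun g hg => hA g (List.mem_cons_of_mem _ hg))
        have hg := hA g List.mem_cons_self
        simp only [Finset.mem_insert, Finset.mem_singleton] at hg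
        simp only [ptApply, List.foldl_cons, Option.bind_some] at h
        simp only [List.length_cons]
        rcases hg with rfl | rfl | rfl
        · have := ih' ⟨q.val - 1, by omega⟩ r h
          simp only at this
          omega
        · have := ih' q r h
          omega
        · simp [c, foldl_none] at h
    rintro w ⟨hA, q, hq⟩
    have h1 := key w hA _ _ (hq ⟨0, by omega⟩)
    have h2 := key w hA _ _ (hq ⟨n - 1, by omega⟩)
    simp only at h1 h2
    omega

end TernaryCounter

/-- For every `n ≥ 7` with `n ≡ 3 (mod 4)`, there is an alphabet of `3` partial
transformations of an `n`-element set admitting a carefully synchronising word, all of whose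
carefully synchronising words have length at least `3 ^ ((n - 3) / 4)`
(simulating a decrementing ternary counter with `(n - 3) / 4` digits). -/
theorem car_lower_bound_ternary_counter (n : ℕ) (hn : 7 ≤ n) (hmod : n % 4 = 3) :
    ∃ A : Finset (Fin n → Option (Fin n)),
      A.card = 3 ∧
      (∃ w, CarefullySync A w) ∧
      (∀ w, CarefullySync A w → 3 ^ ((n - 3) / 4) ≤ w.length) := by
  by_cases h : n ≤ 11
  · obtain ⟨A, h1, h2, h3⟩ := TernaryCounter.small n hn
    refine ⟨A, h1, h2, fun w hw => le_trans ?_ (h3 w hw)⟩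
    have : n = 7 ∨ n = 11 := by omega
    rcases this with rfl | rfl <;> norm_num
  · have e : (n - 3) / 4 = ((n - 3) / 4 - 1) + 1 := by omega
    rw [e]
    exact TernaryCounter.big _ n (by omega) (by omega)
end

section
/- For every integer b ≥ 2 and every integer k ≥ 1, setting n = (b+1)·k + b, there exists a set A of 3 partial transformations of an n-element set such that A admits a carefully synchronising word, and every carefully synchronising word for A has length at least b^k (equivalently, at least b^((n−b)/(b+1))). -/
namespace CarSync

/-- valid raw states `(p, v)`: `v = B` is the token, `v = -1` the pending digit (only at `p = 0`). -/
def Valid (K B : ℕ) (s : ℕ × ℤ) : Prop :=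
  s.1 ≤ K ∧ -1 ≤ s.2 ∧ s.2 ≤ B ∧ (s.2 = -1 → s.1 = 0)

/-- the rotation letter -/
def lr (K B : ℕ) (s : ℕ × ℤ) : Option (ℕ × ℤ) :=
  some (if s.1 = K then 0 else s.1 + 1, if s.2 = -1 then (B : ℤ) - 1 else s.2)

/-- the decrement letter -/
def ld (K B : ℕ) (s : ℕ × ℤ) : Option (ℕ × ℤ) :=
  if s.1 = 0 then
    (if s.2 = -1 then some (1, (B : ℤ) - 1) else if s.2 = B then some (1, (B : ℤ)) else none)
  else if s.1 = K then (if s.2 = B then some (K, (B : ℤ)) else some (0, s.2 - 1))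
  else some (s.1 + 1, s.2)

/-- the initialising letter -/
def la (K B : ℕ) (s : ℕ × ℤ) : Option (ℕ × ℤ) :=
  if s.1 = K then some (K, (B : ℤ)) else some (s.1, (B : ℤ) - 1)

/-- transport of a raw letter to `Fin n` -/
def hat {n : ℕ} (cod : ℕ × ℤ → Fin n) (dec : Fin n → ℕ × ℤ) (f : ℕ × ℤ → Option (ℕ × ℤ)) :
    Fin n → Option (Fin n) := fun q => (f (dec q)).map cod

theorem ptApply_cons {n : ℕ} (g : Fin n → Option (Fin n)) (w : List (Fin n → Option (Fin n)))
    (q : Fin n) : ptApply (g :: w) q = (g q).bind (ptApply w) := by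
  unfold ptApply
  simp only [List.foldl_cons, Option.bind_some]
  cases h : g q with
  | some a => simp
  | none =>
    simp only [Option.bind_none]
    clear h
    induction w with
    | nil => rfl
    | cons a t ih => simpa using ih

theorem exists_coding (K B n : ℕ) (hn : (K + 1) * (B + 1) + 1 ≤ n) :
    ∃ (cod : ℕ × ℤ → Fin n) (dec : Fin n → ℕ × ℤ),
      (∀ s, Valid K B s → dec (cod s) = s) ∧ ∀ q, Valid K B (dec q) := by
  have hn0 : 0 < n := by omega
  refine ⟨fun s => ⟨(s.1 * (B + 1) + (s.2 + 1).toNat) % n, Nat.mod_lt _ hn0⟩,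
    fun q => if q.1 = 0 ∨ (K + 1) * (B + 1) < q.1 then (0, -1)
      else ((q.1 - 1) / (B + 1), (((q.1 - 1) % (B + 1) : ℕ) : ℤ)), ?_, ?_⟩
  · rintro ⟨p, v⟩ ⟨h1, h2, h3, h4⟩
    simp only at h1 h2 h3 h4
    by_cases hv : v = -1
    · have hp := h4 hv
      subst hv hp
      simp
    · obtain ⟨u, rfl⟩ : ∃ u : ℕ, v = u := ⟨v.toNat, by omega⟩
      have hu : u ≤ B := by omega
      have e1 : ((u : ℤ) + 1).toNat = u + 1 := by omega
      have hmul : p * (B + 1) ≤ K * (B + 1) := Nat.mul_le_mul_right _ h1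
      have hexp : (K + 1) * (B + 1) = K * (B + 1) + (B + 1) := by ring
      have e2 : (p * (B + 1) + (u + 1)) % n = p * (B + 1) + (u + 1) := Nat.mod_eq_of_lt (by omega)
      simp only [e1, e2]
      rw [if_neg (by omega)]
      have e3 : p * (B + 1) + (u + 1) - 1 = u + (B + 1) * p := by
        rw [mul_comm]; omega
      rw [e3, Nat.add_mul_div_left _ _ (by omega), Nat.add_mul_mod_self_left,
        Nat.div_eq_of_lt (by omega), Nat.mod_eq_of_lt (by omega)]
      simp
  · intro q
    simp only
    split_ifs with h
    · exact ⟨by simp, by simp, by simp, by simp⟩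
    · have h1 : (q.1 - 1) / (B + 1) < K + 1 := by
        rw [Nat.div_lt_iff_lt_mul (by omega)]; omega
      have h2 := Nat.mod_lt (q.1 - 1) (show B + 1 > 0 by omega)
      refine ⟨?_, ?_, ?_, ?_⟩ <;> simp only <;> omega

/-- position of digit `j` when the token is at position `t` -/
def pos (K t j : ℕ) : ℕ := if j + 1 ≤ t then t - 1 - j else t + K - j

/-- counter value -/
def U (K B : ℕ) (x : ℕ → ℤ) : ℤ := ∑ j ∈ Finset.range K, x j * (B : ℤ) ^ j

/-- potential -/
def Psi (K B t : ℕ) (x : ℕ → ℤ) : ℤ :=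
  ((K : ℤ) + 1) * (U K B x + 1) + (if t = 0 then 0 else (K : ℤ) + 1 - t)

/-- configurations -/
def Conf (K B t : ℕ) (x : ℕ → ℤ) : Prop :=
  t ≤ K ∧ ∀ j < K, -1 ≤ x j ∧ x j ≤ (B : ℤ) - 1 ∧ (x j = -1 → j + 1 = t)

/-- next token position -/
def nx (K t : ℕ) : ℕ := if t = K then 0 else t + 1

/-- digits after rotation -/
def xr (B : ℕ) (x : ℕ → ℤ) : ℕ → ℤ := fun j => if x j = -1 then (B : ℤ) - 1 else x j

/-- digits after decrement -/
def xd (B t : ℕ) (x : ℕ → ℤ) : ℕ → ℤ := fun j =>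
  x j - (if j = t then 1 else 0) + (if j + 1 = t then (B : ℤ) else 0)

theorem conf_valid {K B t : ℕ} {x : ℕ → ℤ} (h : Conf K B t x) :
    Valid K B (t, (B : ℤ)) ∧ ∀ j < K, Valid K B (pos K t j, x j) := by
  obtain ⟨ht, hx⟩ := h
  refine ⟨⟨ht, by simp only; omega, by simp, by simp only; omega⟩, fun j hj => ?_⟩
  obtain ⟨h1, h2, h3⟩ := hx j hj
  refine ⟨?_, h1, by simp only; omega, fun h => ?_⟩
  · unfold pos; simp only; split_ifs <;> omega
  · have := h3 h
    unfold pos; simp only; split_ifs <;> omega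

theorem U_top (B : ℕ) (x : ℕ → ℤ) (m : ℕ) (hx : ∀ j < m, x j ≤ (B : ℤ) - 1) :
    U m B x ≤ (B : ℤ) ^ m - 1 := by
  induction m with
  | zero => simp [U]
  | succ m ih =>
    have := ih (fun j hj => hx j (by omega))
    have h2 := hx m (by omega)
    unfold U at *
    rw [Finset.sum_range_succ, pow_succ]
    have h3 : (0 : ℤ) ≤ (B : ℤ) ^ m := by positivity
    nlinarith

theorem value_start (B : ℕ) (m : ℕ) : U m B (fun _ => (B : ℤ) - 1) = (B : ℤ) ^ m - 1 := by
  induction m with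
  | zero => simp [U]
  | succ m ih =>
    unfold U at *
    rw [Finset.sum_range_succ, pow_succ, ih]
    ring

theorem U_overflow (B K : ℕ) (hK : 1 ≤ K) (x : ℕ → ℤ) (hx : ∀ j < K, x j ≤ (B : ℤ) - 1)
    (h : x (K - 1) = -1) : U K B x ≤ -1 := by
  obtain ⟨m, rfl⟩ : ∃ m, K = m + 1 := ⟨K - 1, by omega⟩
  have := U_top B x m (fun j hj => hx j (by omega))
  simp only [Nat.add_sub_cancel] at h
  unfold U at *
  rw [Finset.sum_range_succ, h]
  linarith

theorem U_xr (B K : ℕ) (x : ℕ → ℤ) : U K B x ≤ U K B (xr B x) := by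
  unfold U xr
  refine Finset.sum_le_sum fun j _ => mul_le_mul_of_nonneg_right ?_ (by positivity)
  split_ifs <;> omega

theorem U_xd (B K t : ℕ) (ht : t < K) (x : ℕ → ℤ) :
    U K B (xd B t x) = U K B x - (if t = 0 then 1 else 0) := by
  unfold U xd
  have e : ∀ j, (x j - (if j = t then 1 else 0) + (if j + 1 = t then (B : ℤ) else 0)) * (B : ℤ) ^ j
      = x j * (B : ℤ) ^ j - (if j = t then (B : ℤ) ^ t else 0)
        + (if j + 1 = t then (B : ℤ) ^ t else 0) := by
    intro j
    by_cases h1 : j = t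
    · subst h1; simp; ring
    · by_cases h2 : j + 1 = t
      · subst h2; simp; ring
      · simp [h1, h2]
  simp only [e, Finset.sum_add_distrib, Finset.sum_sub_distrib]
  rw [Finset.sum_ite_eq']
  rcases t with _ | t
  · have : 0 < K := ht
    simp [this.ne']
  · have h2 : t < K := by omega
    simp [Finset.sum_ite_eq', ht, h2]

theorem conf_r {K B t : ℕ} (hB : 1 ≤ B) {x : ℕ → ℤ} (h : Conf K B t x) :
    Conf K B (nx K t) (xr B x) := by
  obtain ⟨ht, hx⟩ := h
  refine ⟨by unfold nx; split_ifs <;> omega, fun j hj => ?_⟩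
  obtain ⟨h1, h2, h3⟩ := hx j hj
  unfold xr
  split_ifs <;> refine ⟨?_, ?_, ?_⟩ <;> omega

theorem conf_d {K B t : ℕ} (hB : 1 ≤ B) {x : ℕ → ℤ} (h : Conf K B t x) (htK : t < K)
    (hp : ∀ j, j + 1 = t → x j = -1) :
    Conf K B (t + 1) (xd B t x) := by
  obtain ⟨ht, hx⟩ := h
  refine ⟨by omega, fun j hj => ?_⟩
  obtain ⟨h1, h2, h3⟩ := hx j hj
  have h4 := hp j
  unfold xd
  split_ifs with h5 h6 h6 <;> refine ⟨?_, ?_, ?_⟩ <;> omega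

theorem psi_r {K B t : ℕ} {x : ℕ → ℤ} (ht : t ≤ K) :
    Psi K B t x ≤ Psi K B (nx K t) (xr B x) + 1 := by
  have h := U_xr B K x
  have h2 : ((K : ℤ) + 1) * (U K B x + 1) ≤ ((K : ℤ) + 1) * (U K B (xr B x) + 1) :=
    mul_le_mul_of_nonneg_left (by linarith) (by positivity)
  unfold Psi nx
  by_cases h3 : t = K
  · simp only [h3, if_true]
    split_ifs <;> omega
  · simp only [h3, if_false, Nat.succ_ne_zero]
    split_ifs <;> push_cast <;> omega

theorem psi_d {K B t : ℕ} {x : ℕ → ℤ} (ht : t < K) :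
    Psi K B t x = Psi K B (t + 1) (xd B t x) + 1 := by
  unfold Psi
  rw [U_xd B K t ht]
  by_cases h : t = 0
  · subst h; simp; ring
  · simp [h]; ring

theorem psi_low {K B t : ℕ} {x : ℕ → ℤ} (h : Conf K B t x) :
    -(((K : ℤ) + 1) * ∑ j ∈ Finset.range K, (B : ℤ) ^ j) ≤ Psi K B t x := by
  have h1 : -(∑ j ∈ Finset.range K, (B : ℤ) ^ j) ≤ U K B x := by
    unfold U
    rw [← Finset.sum_neg_distrib]
    refine Finset.sum_le_sum fun j hj => ?_
    have := (h.2 j (Finset.mem_range.1 hj)).1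
    have h3 : (0 : ℤ) ≤ (B : ℤ) ^ j := by positivity
    nlinarith
  have h2 : (0 : ℤ) ≤ (if t = 0 then 0 else (K : ℤ) + 1 - t) := by
    have := h.1
    split_ifs <;> omega
  unfold Psi
  nlinarith

theorem lr_tok (K B t : ℕ) : lr K B (t, (B : ℤ)) = some (nx K t, (B : ℤ)) := by
  unfold lr nx
  simp only
  rw [if_neg (show ¬ ((B : ℤ) = -1) by omega)]

theorem lr_dig {K B t j : ℕ} (x : ℕ → ℤ) (ht : t ≤ K) (hj : j < K) :
    lr K B (pos K t j, x j) = some (pos K (nx K t) j, xr B x j) := by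
  have : (if pos K t j = K then 0 else pos K t j + 1) = pos K (nx K t) j := by
    unfold pos nx
    split_ifs <;> omega
  unfold lr xr
  simp only [this]

theorem ld_tok {K B t : ℕ} (ht : t < K) : ld K B (t, (B : ℤ)) = some (t + 1, (B : ℤ)) := by
  unfold ld
  simp only
  by_cases h : t = 0
  · subst h
    have : ¬ ((B : ℤ) = -1) := by omega
    simp [this]
  · rw [if_neg h, if_neg (by omega)]

theorem ld_dig {K B t j : ℕ} (x : ℕ → ℤ) (h : Conf K B t x) (ht : t < K) (hj : j < K)
    (hp : ∀ j, j + 1 = t → x j = -1) :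
    ld K B (pos K t j, x j) = some (pos K (t + 1) j, xd B t x j) := by
  obtain ⟨h1, h2, h3⟩ := h.2 j hj
  have h4 := hp j
  unfold ld xd
  simp only
  by_cases hjt : j + 1 = t
  · have e1 : pos K t j = 0 := by unfold pos; split_ifs <;> omega
    have e2 : pos K (t + 1) j = 1 := by unfold pos; split_ifs <;> omega
    rw [if_pos e1, if_pos (h4 hjt), e2, h4 hjt, if_neg (by omega), if_pos hjt]
    simp only [Option.some.injEq, Prod.mk.injEq, true_and]
    ring
  · have e1 : pos K t j ≠ 0 := by unfold pos; split_ifs <;> omega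
    rw [if_neg e1, if_neg hjt]
    by_cases hj2 : j = t
    · have e1 : pos K t j = K := by unfold pos; split_ifs <;> omega
      have e2 : pos K (t + 1) j = 0 := by unfold pos; split_ifs <;> omega
      rw [if_pos e1, if_neg (by omega), if_pos hj2, e2, add_zero]
    · have e1 : pos K t j ≠ K := by unfold pos; split_ifs <;> omega
      have e2 : pos K (t + 1) j = pos K t j + 1 := by unfold pos; split_ifs <;> omega
      rw [if_neg e1, if_neg hj2, e2, add_zero, sub_zero]

theorem ld_block {K B : ℕ} {v : ℤ} (h1 : v ≠ -1) (h2 : v ≠ B) : ld K B (0, v) = none := by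
  simp [ld, h1, h2]

section run
variable {K B n : ℕ} {cod : ℕ × ℤ → Fin n} {dec : Fin n → ℕ × ℤ}

theorem pt_hat (hcd : ∀ s, Valid K B s → dec (cod s) = s) (f : ℕ × ℤ → Option (ℕ × ℤ))
    (w : List (Fin n → Option (Fin n))) (s : ℕ × ℤ) (hs : Valid K B s) :
    ptApply (hat cod dec f :: w) (cod s) = (f s).bind (fun s' => ptApply w (cod s')) := by
  rw [ptApply_cons, hat, hcd s hs]
  cases f s <;> rfl

theorem conf_start (hB : 1 ≤ B) : Conf K B K (fun _ => (B : ℤ) - 1) :=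
  ⟨le_rfl, fun j _ => ⟨by simp only; omega, by simp only; omega, by simp only; omega⟩⟩

theorem psi_start (hK : 1 ≤ K) :
    Psi K B K (fun _ => (B : ℤ) - 1) = ((K : ℤ) + 1) * (B : ℤ) ^ K + 1 := by
  unfold Psi
  rw [value_start, if_neg (by omega)]
  ring

theorem lower (hK : 1 ≤ K) (hB : 1 ≤ B) (hcd : ∀ s, Valid K B s → dec (cod s) = s)
    (w : List (Fin n → Option (Fin n)))
    (hw : ∀ g ∈ w, g = hat cod dec (la K B) ∨ g = hat cod dec (lr K B) ∨ g = hat cod dec (ld K B))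
    (q₀ : Fin n) : ∀ (t : ℕ) (x : ℕ → ℤ), Conf K B t x →
      ptApply w (cod (t, (B : ℤ))) = some q₀ →
      (∀ j < K, ptApply w (cod (pos K t j, x j)) = some q₀) →
      Psi K B t x ≤ w.length ∨ ((K : ℤ) + 1) * (B : ℤ) ^ K + 1 ≤ w.length := by
  induction w with
  | nil =>
    intro t x hc h1 h2
    exfalso
    have hv := conf_valid hc
    have h3 := h2 0 hK
    simp only [ptApply, List.foldl_nil, Option.some.injEq] at h1 h3
    have h4 := congrArg dec (h1.trans h3.symm)
    rw [hcd _ hv.1, hcd _ (hv.2 0 hK)] at h4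
    have h5 := congrArg Prod.snd h4
    have h6 := (hc.2 0 hK).2.1
    simp only at h5
    omega
  | cons g w ih =>
    intro t x hc h1 h2
    have ih := ih (fun g hg => hw g (List.mem_cons_of_mem _ hg))
    have hv := conf_valid hc
    rcases hw g List.mem_cons_self with rfl | rfl | rfl
    · right
      have key : ∀ p ≤ K, ∃ v, Valid K B (p, v) ∧
          ptApply (hat cod dec (la K B) :: w) (cod (p, v)) = some q₀ := by
        intro p hp
        by_cases hpt : p = t
        · exact ⟨B, hpt ▸ hv.1, hpt ▸ h1⟩
        · obtain ⟨j, hj, hjp⟩ : ∃ j < K, pos K t j = p := by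
            have := hc.1
            by_cases hlt : p < t
            · exact ⟨t - 1 - p, by omega, by unfold pos; split_ifs <;> omega⟩
            · exact ⟨t + K - p, by omega, by unfold pos; split_ifs <;> omega⟩
          exact ⟨x j, hjp ▸ hv.2 j hj, hjp ▸ h2 j hj⟩
      have := ih K (fun _ => (B : ℤ) - 1) (conf_start hB) ?_ ?_
      · rw [psi_start hK] at this
        simp only [List.length_cons]
        push_cast
        omega
      · obtain ⟨v, hv, he⟩ := key K le_rfl
        rw [pt_hat hcd _ _ _ hv] at he
        simpa [la] using he
      · intro j hj
        have hpj : pos K K j < K := by unfold pos; split_ifs <;> omega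
        obtain ⟨v, hv, he⟩ := key (pos K K j) hpj.le
        rw [pt_hat hcd _ _ _ hv] at he
        simpa [la, hpj.ne] using he
    · have := ih (nx K t) (xr B x) (conf_r hB hc) ?_ ?_
      · have h3 := psi_r (B := B) (x := x) hc.1
        simp only [List.length_cons]
        push_cast
        omega
      · rw [pt_hat hcd _ _ _ hv.1, lr_tok] at h1
        exact h1
      · intro j hj
        have := h2 j hj
        rw [pt_hat hcd _ _ _ (hv.2 j hj), lr_dig x hc.1 hj] at this
        exact this
    · have hp : ∀ j, j + 1 = t → x j = -1 := by
        intro j hj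
        by_contra hne
        have hjK : j < K := by have := hc.1; omega
        have := h2 j hjK
        have e : pos K t j = 0 := by unfold pos; split_ifs <;> omega
        rw [pt_hat hcd _ _ _ (hv.2 j hjK), e,
          ld_block hne (by have := (hc.2 j hjK).2.1; omega)] at this
        simp at this
      by_cases htK : t = K
      · left
        subst htK
        have hU := U_overflow B t hK x (fun j hj => (hc.2 j hj).2.1) (hp (t - 1) (by omega))
        have h0 : ((t : ℤ) + 1) * (U t B x + 1) ≤ 0 :=
          mul_nonpos_of_nonneg_of_nonpos (by positivity) (by linarith)
        unfold Psi
        rw [if_neg (by omega)]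
        simp only [List.length_cons]
        push_cast
        omega
      · have htK : t < K := lt_of_le_of_ne hc.1 htK
        have := ih (t + 1) (xd B t x) (conf_d hB hc htK hp) ?_ ?_
        · have h3 := psi_d (B := B) (x := x) htK
          simp only [List.length_cons]
          push_cast
          omega
        · rw [pt_hat hcd _ _ _ hv.1, ld_tok htK] at h1
          exact h1
        · intro j hj
          have := h2 j hj
          rw [pt_hat hcd _ _ _ (hv.2 j hj), ld_dig x hc htK hj hp] at this
          exact this

/-- word over the three letters -/
def Wd (K B : ℕ) {n : ℕ} (cod : ℕ × ℤ → Fin n) (dec : Fin n → ℕ × ℤ)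
    (w : List (Fin n → Option (Fin n))) : Prop :=
  ∀ g ∈ w, g = hat cod dec (la K B) ∨ g = hat cod dec (lr K B) ∨ g = hat cod dec (ld K B)

theorem wd_a {w : List (Fin n → Option (Fin n))} (h : Wd K B cod dec w) :
    Wd K B cod dec (hat cod dec (la K B) :: w) := by
  intro g hg
  rcases List.mem_cons.1 hg with rfl | hg
  · simp
  · exact h g hg

theorem wd_r {w : List (Fin n → Option (Fin n))} (h : Wd K B cod dec w) :
    Wd K B cod dec (hat cod dec (lr K B) :: w) := by
  intro g hg
  rcases List.mem_cons.1 hg with rfl | hg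
  · simp
  · exact h g hg

theorem wd_d {w : List (Fin n → Option (Fin n))} (h : Wd K B cod dec w) :
    Wd K B cod dec (hat cod dec (ld K B) :: w) := by
  intro g hg
  rcases List.mem_cons.1 hg with rfl | hg
  · simp
  · exact h g hg

theorem ending (hK : 1 ≤ K) (hB : 1 ≤ B) (hcd : ∀ s, Valid K B s → dec (cod s) = s) (m : ℕ)
    (hm : m < K) : ∃ w q₀, Wd K B cod dec w ∧ ptApply w (cod (K, (B : ℤ))) = some q₀ ∧
      ∀ i, K - m ≤ i → i < K → ptApply w (cod (i, (B : ℤ) - 1)) = some q₀ := by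
  have vT : Valid K B (K, (B : ℤ)) := (conf_valid (conf_start (K := K) hB)).1
  have vD : ∀ i ≤ K, ∀ v : ℤ, 0 ≤ v → v ≤ B → Valid K B (i, v) := fun i hi v h1 h2 =>
    ⟨hi, by simp only; omega, h2, by simp only; omega⟩
  induction m with
  | zero => exact ⟨[], cod (K, (B : ℤ)), by simp [Wd], rfl, fun i h1 h2 => by omega⟩
  | succ m ih =>
    obtain ⟨w, q₀, hw, h1, h2⟩ := ih (by omega)
    refine ⟨_, q₀, wd_d (wd_a hw), ?_, fun i hi1 hi2 => ?_⟩
    · rw [pt_hat hcd _ _ _ vT]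
      have : ld K B (K, (B : ℤ)) = some (K, (B : ℤ)) := by
        simp [ld, show K ≠ 0 by omega]
      rw [this, Option.bind_some, pt_hat hcd _ _ _ vT]
      simpa [la] using h1
    · rw [pt_hat hcd _ _ _ (vD i hi2.le _ (by omega) (by omega))]
      have : ld K B (i, (B : ℤ) - 1) = some (i + 1, (B : ℤ) - 1) := by
        simp [ld, show i ≠ 0 by omega, show i ≠ K by omega]
      rw [this, Option.bind_some, pt_hat hcd _ _ _ (vD (i + 1) hi2 _ (by omega) (by omega))]
      by_cases hiK : i + 1 = K
      · simpa [la, hiK] using h1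
      · simpa [la, hiK] using h2 (i + 1) (by omega) (by omega)

theorem upper (hK : 1 ≤ K) (hB : 1 ≤ B) (hcd : ∀ s, Valid K B s → dec (cod s) = s) (N : ℕ) :
    ∀ (t : ℕ) (x : ℕ → ℤ), Conf K B t x →
      Psi K B t x + (((K : ℤ) + 1) * ∑ j ∈ Finset.range K, (B : ℤ) ^ j) < N →
      ∃ w q₀, Wd K B cod dec w ∧ ptApply w (cod (t, (B : ℤ))) = some q₀ ∧
        ∀ j < K, ptApply w (cod (pos K t j, x j)) = some q₀ := by
  induction N with
  | zero =>
    intro t x hc h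
    have := psi_low hc
    push_cast at h
    omega
  | succ N ih =>
    intro t x hc h
    have hv := conf_valid hc
    push_cast at h
    by_cases hp : ∀ j, j + 1 = t → x j = -1
    · by_cases htK : t = K
      · subst htK
        obtain ⟨w, q₀, hw, h1, h2⟩ := ending hK hB hcd (t - 1) (by omega)
        refine ⟨_, q₀, wd_d (wd_a hw), ?_, fun j hj => ?_⟩
        · rw [pt_hat hcd _ _ _ hv.1]
          have : ld t B (t, (B : ℤ)) = some (t, (B : ℤ)) := by
            simp [ld, show t ≠ 0 by omega]
          rw [this, Option.bind_some, pt_hat hcd _ _ _ hv.1]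
          simpa [la] using h1
        · rw [pt_hat hcd _ _ _ (hv.2 j hj)]
          obtain ⟨b1, b2, b3⟩ := hc.2 j hj
          have e : pos t t j = t - 1 - j := by unfold pos; split_ifs <;> omega
          have : ∃ v : ℤ, 0 ≤ v ∧ v ≤ B ∧ ld t B (pos t t j, x j) = some (t - 1 - j + 1, v) := by
            by_cases hj1 : j + 1 = t
            · refine ⟨(B : ℤ) - 1, by omega, by omega, ?_⟩
              rw [e, show t - 1 - j = 0 by omega, hp j hj1]
              simp [ld]
            · refine ⟨x j, by omega, by omega, ?_⟩
              rw [e]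
              simp [ld, show t - 1 - j ≠ 0 by omega, show t - 1 - j ≠ t by omega]
          obtain ⟨v, hv0, hv1, he⟩ := this
          rw [he, Option.bind_some, pt_hat hcd]
          · by_cases hj0 : t - 1 - j + 1 = t
            · simpa [la, hj0] using h1
            · simpa [la, hj0] using h2 (t - 1 - j + 1) (by omega) (by omega)
          · exact ⟨by simp only; omega, by simp only; omega, hv1, by simp only; omega⟩
      · have htK : t < K := lt_of_le_of_ne hc.1 htK
        have h3 := psi_d (B := B) (x := x) htK
        obtain ⟨w, q₀, hw, h1, h2⟩ := ih (t + 1) (xd B t x) (conf_d hB hc htK hp) (by omega)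
        refine ⟨_, q₀, wd_d hw, ?_, fun j hj => ?_⟩
        · rw [pt_hat hcd _ _ _ hv.1, ld_tok htK]
          exact h1
        · rw [pt_hat hcd _ _ _ (hv.2 j hj), ld_dig x hc htK hj hp]
          exact h2 j hj
    · push Not at hp
      obtain ⟨i, hi, hxi⟩ := hp
      have hx : U K B (xr B x) = U K B x := by
        unfold U
        refine Finset.sum_congr rfl fun j hj => ?_
        have hj := (hc.2 j (Finset.mem_range.1 hj)).2.2
        have : x j ≠ -1 := fun h => by
          have := hj h
          obtain rfl : j = i := by omega
          exact hxi h
        simp [xr, this]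
      have h3 : Psi K B t x = Psi K B (nx K t) (xr B x) + 1 := by
        have := hc.1
        unfold Psi nx
        rw [hx]
        by_cases h3 : t = K
        · simp only [h3, if_true]
          split_ifs <;> omega
        · simp only [h3, if_false, Nat.succ_ne_zero]
          split_ifs <;> push_cast <;> omega
      obtain ⟨w, q₀, hw, h1, h2⟩ := ih (nx K t) (xr B x) (conf_r hB hc) (by omega)
      refine ⟨_, q₀, wd_r hw, ?_, fun j hj => ?_⟩
      · rw [pt_hat hcd _ _ _ hv.1, lr_tok]
        exact h1
      · rw [pt_hat hcd _ _ _ (hv.2 j hj), lr_dig x hc.1 hj]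
        exact h2 j hj

end run

theorem core (K B n : ℕ) (hK : 1 ≤ K) (hB : 1 ≤ B) (hn : (K + 1) * (B + 1) + 1 ≤ n) :
    ∃ A : Finset (Fin n → Option (Fin n)), A.card = 3 ∧ (∃ w, CarefullySync A w) ∧
      ∀ w, CarefullySync A w → (K + 1) * B ^ K + 1 ≤ w.length := by
  classical
  obtain ⟨cod, dec, hcd, hdec⟩ := exists_coding K B n hn
  have vv : ∀ i ≤ K, ∀ v : ℤ, 0 ≤ v → v ≤ B → Valid K B (i, v) := fun i hi v h1 h2 =>
    ⟨hi, by simp only; omega, h2, by simp only; omega⟩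
  have v1 := vv K le_rfl B (by omega) le_rfl
  have v2 := vv 0 (by omega) B (by omega) le_rfl
  have v3 := vv 0 (by omega) (B - 1) (by omega) (by omega)
  have hne : cod (0, (B : ℤ)) ≠ cod (K, (B : ℤ)) := by
    intro h
    have := congrArg dec h
    rw [hcd _ v1, hcd _ v2] at this
    have := congrArg Prod.fst this
    simp only at this
    omega
  have hra : hat cod dec (la K B) ≠ hat cod dec (lr K B) := by
    intro h
    have := congrFun h (cod (K, (B : ℤ)))
    simp only [hat, hcd _ v1] at this
    rw [lr_tok] at this
    simp [la, nx] at this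
    exact hne this.symm
  have hrd : hat cod dec (lr K B) ≠ hat cod dec (ld K B) := by
    intro h
    have := congrFun h (cod (K, (B : ℤ)))
    simp only [hat, hcd _ v1] at this
    rw [lr_tok] at this
    simp [ld, nx, show K ≠ 0 by omega] at this
    exact hne this
  have had : hat cod dec (la K B) ≠ hat cod dec (ld K B) := by
    intro h
    have := congrFun h (cod (0, (B : ℤ) - 1))
    simp only [hat, hcd _ v3] at this
    rw [ld_block (by omega) (by omega)] at this
    simp [la, show 0 ≠ K by omega] at this
  refine ⟨{hat cod dec (la K B), hat cod dec (lr K B), hat cod dec (ld K B)}, ?_, ?_, ?_⟩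
  · exact Finset.card_eq_three.2 ⟨_, _, _, hra, had, hrd, rfl⟩
  · obtain ⟨w, q₀, hw, h1, h2⟩ := upper hK hB hcd
      (Psi K B K (fun _ => (B : ℤ) - 1) +
        (((K : ℤ) + 1) * ∑ j ∈ Finset.range K, (B : ℤ) ^ j) + 1).toNat K _ (conf_start hB)
      (by have := Int.self_le_toNat (Psi K B K (fun _ => (B : ℤ) - 1) +
            (((K : ℤ) + 1) * ∑ j ∈ Finset.range K, (B : ℤ) ^ j) + 1)
          omega)
    refine ⟨hat cod dec (la K B) :: w, ?_, q₀, fun q => ?_⟩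
    · intro g hg
      simpa using wd_a hw g hg
    · rw [ptApply_cons, hat]
      have hq := (hdec q).1
      by_cases hqK : (dec q).1 = K
      · simpa [la, hqK] using h1
      · have := h2 (K - 1 - (dec q).1) (by omega)
        have e : pos K K (K - 1 - (dec q).1) = (dec q).1 := by
          unfold pos; split_ifs <;> omega
        rw [e] at this
        simpa [la, hqK] using this
  · rintro w ⟨hw, q₀, hq⟩
    have := lower hK hB hcd w (fun g hg => by simpa using hw g hg) q₀ K _ (conf_start hB)
      (hq _) (fun j _ => hq _)
    rw [psi_start hK, or_self] at this
    exact_mod_cast this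

theorem pow_bound (m j : ℕ) (h : j ≤ m) : (m + 1) ^ j ≤ (j + 1) * m ^ j := by
  induction j with
  | zero => simp
  | succ j ih =>
    have h1 := ih (by omega)
    calc (m + 1) ^ (j + 1) = (m + 1) ^ j * (m + 1) := pow_succ _ _
      _ ≤ ((j + 1) * m ^ j) * (m + 1) := Nat.mul_le_mul_right _ h1
      _ = (j + 1) * m ^ (j + 1) + m ^ j * (j + 1) := by ring
      _ ≤ (j + 1) * m ^ (j + 1) + m ^ j * m := by gcongr
      _ = (j + 1 + 1) * m ^ (j + 1) := by ring

end CarSync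

/-- For every base `b ≥ 2` and `k ≥ 1`, with `n = (b + 1) * k + b`, there is an alphabet of
`3` partial transformations of an `n`-element set admitting a carefully synchronising word,
all of whose carefully synchronising words have length at least `b ^ k`
(simulating a decrementing base-`b` counter with `k` digits). -/
theorem car_lower_bound_base_b (b k : ℕ) (hb : 2 ≤ b) (hk : 1 ≤ k) :
    ∃ A : Finset (Fin ((b + 1) * k + b) → Option (Fin ((b + 1) * k + b))),
      A.card = 3 ∧
      (∃ w, CarefullySync A w) ∧
      (∀ w, CarefullySync A w → b ^ k ≤ w.length) := by
  by_cases h : b ≤ k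
  · obtain ⟨m, rfl⟩ : ∃ m, k = m + 1 := ⟨k - 1, by omega⟩
    obtain ⟨A, h1, h2, h3⟩ := CarSync.core m b ((b + 1) * (m + 1) + b) (by omega) (by omega)
      (by rw [mul_comm (m + 1)]; omega)
    refine ⟨A, h1, h2, fun w hw => le_trans ?_ (h3 w hw)⟩
    have : b ^ m * b ≤ b ^ m * (m + 1) := Nat.mul_le_mul_left _ h
    rw [pow_succ, mul_comm (m + 1)]
    omega
  · obtain ⟨m, rfl⟩ : ∃ m, b = m + 1 := ⟨b - 1, by omega⟩
    obtain ⟨A, h1, h2, h3⟩ := CarSync.core k m ((m + 1 + 1) * k + (m + 1)) hk (by omega)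
      (by nlinarith)
    refine ⟨A, h1, h2, fun w hw => le_trans ?_ (h3 w hw)⟩
    have := CarSync.pow_bound m k (by omega)
    omega
end

section
/- For every natural number n ≥ 8 with n ≡ 3 (mod 5), there exists a set A of 2 partial transformations of an n-element set such that A admits a carefully synchronising word, and every carefully synchronising word for A has length at least 3^((n−3)/5). -/
/-- Raw states: `D p x` digit `x` at position `p`, `E` a fresh digit at position `0`,
`N t` a verified zero shifted `t` places below, `R t` the reset ring. -/
inductive CSt where
  | D (p x : ℕ) : CSt
  | E : CSt
  | N (t : ℕ) : CSt
  | R (t : ℕ) : CSt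

namespace CSt

/-- The shift letter. -/
def stepB (k : ℕ) : CSt → CSt
  | D 0 0 => N 1
  | D 0 (_ + 1) => R 1
  | D (p + 1) x => D p x
  | E => R 1
  | N t => if t + 1 < k then N (t + 1) else R 0
  | R t => if t + 1 < k then R (t + 1) else R 0

/-- The decrement-and-shift-back letter. -/
def stepA (k : ℕ) : CSt → Option CSt
  | D 0 0 => none
  | D 0 (x + 1) => some (D 1 x)
  | D (p + 1) x => if p + 1 < k then some (D (p + 2) x) else
      if x = 0 then some (D (p + 1) 2) else none
  | E => some (D 1 2)
  | N 0 => none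
  | N 1 => some E
  | N (t + 2) => some (N (t + 1))
  | R 0 => some (D 1 2)
  | R (t + 1) => some (D (k - t) 2)

/-- Both letters: `true` is `a`, `false` is `b`. -/
def step (k : ℕ) : Bool → CSt → Option CSt
  | true, s => stepA k s
  | false, s => some (stepB k s)

/-- Running a word. -/
def run (k : ℕ) : List Bool → CSt → Option CSt
  | [], s => some s
  | l :: w, s => (step k l s).bind (run k w)

/-- The states that really occur. -/
def Valid (k : ℕ) : CSt → Prop
  | D p x => p ≤ k ∧ x ≤ 2
  | E => True
  | N t => 1 ≤ t ∧ t < k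
  | R t => t < k

theorem valid_step {k : ℕ} (hk : 2 ≤ k) (l : Bool) (s s' : CSt) (hs : Valid k s)
    (h : step k l s = some s') : Valid k s' := by
  cases l
  · simp only [step, Option.some.injEq] at h
    subst h
    rcases s with ⟨_ | p, _ | x⟩ | _ | t | t <;> simp only [stepB, Valid] at * <;>
      (try split_ifs) <;> (try simp only [Valid]) <;> omega
  · simp only [step] at h
    rcases s with ⟨_ | p, _ | x⟩ | _ | ⟨_ | _ | t⟩ | ⟨_ | t⟩ <;> simp only [stepA, Valid] at * <;>
      (try split_ifs at h) <;> simp at h <;> subst h <;> simp only [Valid] <;> omega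

/-! ### Lower bound -/

/-- Description of the token number `j` with value `x` at level `e`. -/
def Tok (k e : ℕ) (pre : Bool) (j x : ℕ) (s : CSt) : Prop :=
  x ≤ 2 ∧
  ((e < j ∧ s = D (j - e) x) ∨
   (e < j ∧ j < k ∧ x = 2 ∧ s = N (k + e - j)) ∨
   (e < j ∧ j < k + e ∧ x = 2 ∧ s = R (k + e - j)) ∨
   (e = j ∧ pre = true ∧ s = D 0 x) ∨
   (e = j ∧ pre = false ∧ x = 2 ∧ s = E) ∨
   (e = j ∧ pre = false ∧ x = 2 ∧ s = R 0) ∨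
   (j < e ∧ pre = true ∧ x = 0 ∧ s = N (e - j)) ∨
   (j < e ∧ pre = false ∧ x = 2 ∧ s = N (e - j)))

/-- The configuration invariant. -/
def Inv (k e : ℕ) (pre : Bool) (v : ℕ → ℕ) (S : Set CSt) : Prop :=
  e ≤ k ∧ (e = 0 → pre = false) ∧ ∀ j, 1 ≤ j → j ≤ k → ∃ s ∈ S, Tok k e pre j (v j) s

/-- Counter value. -/
def val (k : ℕ) (v : ℕ → ℕ) : ℕ := ∑ i ∈ Finset.range k, v (i + 1) * 3 ^ i

/-- Potential. -/
def pot (k : ℕ) (pre : Bool) (v : ℕ → ℕ) : ℕ := 2 * val k v + if pre then 0 else 1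

theorem val_succ (k : ℕ) (v : ℕ → ℕ) : val (k + 1) v = val k v + v (k + 1) * 3 ^ k := by
  simp [val, Finset.sum_range_succ]

theorem val_lt (k : ℕ) (v : ℕ → ℕ) (h : ∀ j, 1 ≤ j → j ≤ k → v j ≤ 2) : val k v < 3 ^ k := by
  induction k with
  | zero => simp [val]
  | succ k ih =>
    rw [val_succ, pow_succ]
    have h1 := ih (fun j a b => h j a (by omega))
    have h2 := h (k + 1) (by omega) le_rfl
    have : v (k + 1) * 3 ^ k ≤ 2 * 3 ^ k := Nat.mul_le_mul_right _ h2
    omega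

theorem val_two (k : ℕ) (v : ℕ → ℕ) (h : ∀ j, 1 ≤ j → j ≤ k → v j = 2) : val k v + 1 = 3 ^ k := by
  induction k with
  | zero => simp [val]
  | succ k ih =>
    rw [val_succ, pow_succ, h (k + 1) (by omega) le_rfl]
    have h1 := ih (fun j a b => h j a (by omega))
    omega

theorem val_zero (k : ℕ) (v : ℕ → ℕ) (h : ∀ j, 1 ≤ j → j ≤ k → v j = 0) : val k v = 0 := by
  induction k with
  | zero => simp [val]
  | succ k ih =>
    rw [val_succ, h (k + 1) (by omega) le_rfl, ih (fun j a b => h j a (by omega))]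
    omega

theorem val_mono (k : ℕ) (v v' : ℕ → ℕ) (h : ∀ j, 1 ≤ j → j ≤ k → v j ≤ v' j) :
    val k v ≤ val k v' := by
  apply Finset.sum_le_sum
  intro i hi
  exact Nat.mul_le_mul_right _ (h _ (by omega) (by simpa using hi))

theorem val_congr (k : ℕ) (v v' : ℕ → ℕ) (h : ∀ j, 1 ≤ j → j ≤ k → v j = v' j) :
    val k v = val k v' :=
  le_antisymm (val_mono k v v' fun j a b => (h j a b).le)
    (val_mono k v' v fun j a b => (h j a b).ge)

theorem val_add (e m : ℕ) (v : ℕ → ℕ) :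
    val (e + m) v = val e v + 3 ^ e * val m (fun j => v (j + e)) := by
  induction m with
  | zero => simp [val]
  | succ m ih =>
    rw [← add_assoc, val_succ, ih, val_succ]
    have : m + 1 + e = e + m + 1 := by omega
    rw [this]
    ring

/-- Rotating low digits to the top, where they become `2`, does not decrease the value. -/
theorem val_rot (k e : ℕ) (he : e ≤ k) (v : ℕ → ℕ) (h : ∀ j, 1 ≤ j → j ≤ k → v j ≤ 2) :
    val k v ≤ val k (fun j => if j ≤ k - e then v (j + e) else 2) := by
  obtain ⟨m, rfl⟩ := Nat.exists_eq_add_of_le he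
  have e1 : e + m - e = m := by omega
  rw [val_add, e1]
  conv_rhs => rw [add_comm e m, val_add]
  rw [val_congr m (fun j => if j ≤ m then v (j + e) else 2) (fun j => v (j + e))
    (fun j a b => by simp [b])]
  have h2 := val_two e (fun j => if j + m ≤ m then v (j + m + e) else 2)
    (fun j a b => by rw [if_neg]; omega)
  have h1 := val_lt e v (fun j a b => h j a (by omega))
  have h3 := val_lt m (fun j => v (j + e)) (fun j a b => h (j + e) (by omega) (by omega))
  set hi := val m (fun j => v (j + e))
  set X := val e (fun j => if j + m ≤ m then v (j + m + e) else 2)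
  rw [← h2] at h1 ⊢
  nlinarith

/-- A borrow followed by a decrement lowers the value by one. -/
theorem val_dec (k e : ℕ) (he1 : 1 ≤ e) (he : e ≤ k) (v : ℕ → ℕ) (h0 : ∀ j, 1 ≤ j → j < e → v j = 0)
    (h1 : 1 ≤ v e) :
    val k v ≤ val k (fun j => if j < e then 2 else if j = e then v j - 1 else v j) + 1 := by
  obtain ⟨m, rfl⟩ := Nat.exists_eq_add_of_le he
  obtain ⟨e, rfl⟩ := Nat.exists_eq_add_of_le' he1
  rw [val_add, val_succ, val_add, val_succ]
  rw [val_zero e v (fun j a b => h0 j a (by omega))]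
  have h2 := val_two e (fun j => if j < e + 1 then 2 else if j = e + 1 then v j - 1 else v j)
    (fun j a b => by rw [if_pos]; omega)
  rw [val_congr m (fun j => (fun j => if j < e + 1 then 2 else if j = e + 1 then v j - 1 else v j)
    (j + (e + 1))) (fun j => v (j + (e + 1))) (fun j a b => by
      simp only []
      rw [if_neg (by omega), if_neg (by omega)])]
  simp only [lt_self_iff_false, if_false, if_true]
  obtain ⟨y, hy⟩ := Nat.exists_eq_add_of_le' h1
  rw [hy, ← h2]
  simp only [Nat.add_sub_cancel]
  nlinarith

theorem tok_distinct {k e : ℕ} (hk : 2 ≤ k) (he : e ≤ k) {pre : Bool} {x y : ℕ} {s : CSt}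
    (h1 : Tok k e pre 1 x s) (h2 : Tok k e pre 2 y s) : False := by
  obtain ⟨hx, h1⟩ := h1
  obtain ⟨hy, h2⟩ := h2
  cases s <;> simp only [CSt.D.injEq, CSt.N.injEq, CSt.R.injEq, reduceCtorEq, and_false, or_false,
    false_or, and_true] at h1 h2 <;> omega

/-- The image of a configuration under a letter. -/
def img (k : ℕ) (l : Bool) (S : Set CSt) : Set CSt := {s' | ∃ s ∈ S, step k l s = some s'}

theorem inv_stepA {k e : ℕ} {pre : Bool} {v : ℕ → ℕ} {S : Set CSt} (hk : 2 ≤ k)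
    (h : Inv k e pre v S) (hd : ∀ s ∈ S, step k true s ≠ none) (hV : 3 ^ (k - 1) ≤ val k v) :
    ∃ e' pre' v', Inv k e' pre' v' (img k true S) ∧ pot k pre v ≤ pot k pre' v' + 1 := by
  obtain ⟨he, hpre, ht⟩ := h
  rcases Nat.eq_zero_or_pos e with rfl | hepos
  · -- the top digit blocks the letter
    exfalso
    obtain ⟨s, hs, hx, hc⟩ := ht k (by omega) le_rfl
    have hvk : v k ≠ 0 := by
      intro h0
      obtain ⟨m, rfl⟩ := Nat.exists_eq_add_of_le' (show 1 ≤ k by omega)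
      rw [val_succ, h0] at hV
      have := val_lt m v (fun j a b => by obtain ⟨s, _, hx, _⟩ := ht j a (by omega); exact hx)
      simp at hV
      omega
    have := hd s hs
    rcases hc with hc | hc | hc | hc | hc | hc | hc | hc
    · obtain ⟨-, rfl⟩ := hc
      apply this
      obtain ⟨m, rfl⟩ := Nat.exists_eq_add_of_le' (show 1 ≤ k by omega)
      simp [step, stepA, hvk]
    all_goals omega
  · obtain ⟨e, rfl⟩ := Nat.exists_eq_add_of_le' hepos
    refine ⟨e, false, fun j => if pre = true then
      (if j < e + 1 then 2 else if j = e + 1 then v j - 1 else v j) else v j,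
      ⟨by omega, by simp, ?_⟩, ?_⟩
    · intro j j1 jk
      obtain ⟨s, hs, hx, hc⟩ := ht j j1 jk
      have hdd := hd s hs
      rcases hc with ⟨h1, rfl⟩ | ⟨h1, h2, h3, rfl⟩ | ⟨h1, h2, h3, rfl⟩ | ⟨h1, h2, rfl⟩ |
        ⟨h1, h2, h3, rfl⟩ | ⟨h1, h2, h3, rfl⟩ | ⟨h1, h2, h3, rfl⟩ | ⟨h1, h2, h3, rfl⟩
      · refine ⟨D (j - e) (v j), ⟨_, hs, ?_⟩, ?_⟩
        · obtain ⟨p, hp⟩ := Nat.exists_eq_add_of_le' (show 1 ≤ j - (e + 1) by omega)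
          have : j - e = p + 2 := by omega
          rw [hp, this]
          simp only [step, stepA]
          rw [if_pos (by omega)]
        · have : ¬ j < e + 1 := by omega
          have : ¬ j = e + 1 := by omega
          refine ⟨by simp [*], Or.inl ⟨by omega, by simp [*]⟩⟩
      · refine ⟨N (k + e - j), ⟨_, hs, ?_⟩, ?_⟩
        · obtain ⟨p, hp⟩ := Nat.exists_eq_add_of_le' (show 2 ≤ k + (e + 1) - j by omega)
          have : k + e - j = p + 1 := by omega
          rw [hp, this]
          simp only [step, stepA]
        · have : ¬ j < e + 1 := by omega
          have : ¬ j = e + 1 := by omega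
          refine ⟨by simp [*], Or.inr (Or.inl ⟨by omega, by omega, by simp [*], rfl⟩)⟩
      · refine ⟨D (j - e) 2, ⟨_, hs, ?_⟩, ?_⟩
        · obtain ⟨p, hp⟩ := Nat.exists_eq_add_of_le' (show 1 ≤ k + (e + 1) - j by omega)
          have : j - e = k - p := by omega
          rw [hp, this]
          simp only [step, stepA]
        · have : ¬ j < e + 1 := by omega
          have : ¬ j = e + 1 := by omega
          refine ⟨by simp [*], Or.inl ⟨by omega, by simp [*]⟩⟩
      · subst h1
        rcases hv : v (e + 1) with _ | y
        · rw [hv] at hdd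
          simp [step, stepA] at hdd
        · refine ⟨D 1 y, ⟨_, hs, ?_⟩, ?_⟩
          · rw [hv]
            simp only [step, stepA]
          · have hx' : v (e + 1) ≤ 2 := hx
            rw [hv] at hx'
            have hy : y ≤ 2 := by omega
            refine ⟨by simp [*], Or.inl ⟨by omega, ?_⟩⟩
            simp [*]
      · subst h1
        exact ⟨D 1 2, ⟨_, hs, by simp [step, stepA]⟩, by simp [*], Or.inl ⟨by omega, by simp [*]⟩⟩
      · subst h1
        exact ⟨D 1 2, ⟨_, hs, by simp [step, stepA]⟩, by simp [*], Or.inl ⟨by omega, by simp [*]⟩⟩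
      all_goals
        rcases Nat.lt_or_ge j e with hje | hje
        · refine ⟨N (e - j), ⟨_, hs, ?_⟩, ?_⟩
          · obtain ⟨p, hp⟩ := Nat.exists_eq_add_of_le' (show 2 ≤ (e + 1) - j by omega)
            have : e - j = p + 1 := by omega
            rw [hp, this]
            simp only [step, stepA]
          · have : j < e + 1 := by omega
            refine ⟨by simp [*], ?_⟩
            simp [*]
        · have : j = e := by omega
          subst this
          refine ⟨E, ⟨_, hs, ?_⟩, ?_⟩
          · have : j + 1 - j = 1 := by omega
            rw [this]
            simp only [step, stepA]
          · refine ⟨by simp [*], ?_⟩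
            simp [*]
    · cases pre
      · simp [pot]
      · have hz : ∀ j, 1 ≤ j → j < e + 1 → v j = 0 := by
          intro j a b
          obtain ⟨s, hs, hx, hc⟩ := ht j a (by omega)
          rcases hc with h | h | h | h | h | h | h | h
          any_goals omega
          simp at h
        have hp : 1 ≤ v (e + 1) := by
          obtain ⟨s, hs, hx, hc⟩ := ht (e + 1) (by omega) (by omega)
          have hdd := hd s hs
          by_contra h0
          have h0 : v (e + 1) = 0 := by omega
          rw [h0] at hc
          simp [step, stepA] at hc hdd
          subst hc
          simp [stepA] at hdd
        have := val_dec k (e + 1) (by omega) he v hz hp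
        change 2 * val k v + 0 ≤ 2 * val k
          (fun j => if j < e + 1 then 2 else if j = e + 1 then v j - 1 else v j) + 1 + 1
        omega

theorem stepB_D (k p x : ℕ) (h : 1 ≤ p) : stepB k (D p x) = D (p - 1) x := by
  obtain ⟨p, rfl⟩ := Nat.exists_eq_add_of_le' h
  rfl

theorem stepB_D0 (k x : ℕ) (h : 1 ≤ x) : stepB k (D 0 x) = R 1 := by
  obtain ⟨p, rfl⟩ := Nat.exists_eq_add_of_le' h
  rfl

theorem stepB_N (k t t' : ℕ) (h : t + 1 < k) (h' : t' = t + 1) : stepB k (N t) = N t' := by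
  subst h'
  simp only [stepB, if_pos h]

theorem stepB_N0 (k t : ℕ) (h : ¬ t + 1 < k) : stepB k (N t) = R 0 := by
  simp only [stepB, if_neg h]

theorem stepB_R (k t t' : ℕ) (h : t + 1 < k) (h' : t' = t + 1) : stepB k (R t) = R t' := by
  subst h'
  simp only [stepB, if_pos h]

theorem stepB_R0 (k t : ℕ) (h : ¬ t + 1 < k) : stepB k (R t) = R 0 := by
  simp only [stepB, if_neg h]

theorem inv_stepB {k e : ℕ} {pre : Bool} {v : ℕ → ℕ} {S : Set CSt} (hk : 2 ≤ k)
    (h : Inv k e pre v S) (hV : 3 ^ (k - 1) ≤ val k v) :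
    ∃ e' pre' v', Inv k e' pre' v' (img k false S) ∧ pot k pre v ≤ pot k pre' v' + 1 := by
  obtain ⟨he, hpre, ht⟩ := h
  have hv2 : ∀ j, 1 ≤ j → j ≤ k → v j ≤ 2 := fun j a b => by
    obtain ⟨s, _, hx, _⟩ := ht j a b; exact hx
  have hmem : ∀ s ∈ S, stepB k s ∈ img k false S := fun s hs => ⟨s, hs, rfl⟩
  have hpot : ∀ pre' v', val k v ≤ val k v' → pot k pre v ≤ pot k pre' v' + 1 := by
    intro pre' v' h
    cases pre <;> cases pre' <;> simp [pot] <;> omega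
  have hpow : 0 < 3 ^ (k - 1) := by positivity
  by_cases hrot : 1 ≤ e ∧ (pre = true → v e ≠ 0)
  · -- rotation
    obtain ⟨he1, hne⟩ := hrot
    -- the next token decides whether the new mode is `pre`
    have key : ∀ j, 1 ≤ j → j ≤ k → ∃ s ∈ img k false S,
        (j + e ≤ k → j = 1 → s = D 0 (v (j + e)) ∨ (v (j + e) = 2 ∧ s = R 0)) ∧
        (j + e ≤ k → 2 ≤ j → s = D (j - 1) (v (j + e)) ∨
          (v (j + e) = 2 ∧ j < k ∧ s = N (k + 1 - j)) ∨ (v (j + e) = 2 ∧ s = R (k + 1 - j))) ∧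
        (k < j + e → j = 1 → s = R 0) ∧
        (k < j + e → 2 ≤ j → (j < k ∧ s = N (k + 1 - j)) ∨ s = R (k + 1 - j)) := by
      intro j j1 jk
      rcases Nat.lt_or_ge k (j + e) with hje | hje
      · -- source token `j + e - k`
        obtain ⟨s, hs, hx, hc⟩ := ht (j + e - k) (by omega) (by omega)
        refine ⟨_, hmem s hs, by omega, by omega, ?_⟩
        rcases hc with ⟨h1, rfl⟩ | ⟨h1, h2, h3, rfl⟩ | ⟨h1, h2, h3, rfl⟩ | ⟨h1, h2, rfl⟩ |
          ⟨h1, h2, h3, rfl⟩ | ⟨h1, h2, h3, rfl⟩ | ⟨h1, h2, h3, rfl⟩ | ⟨h1, h2, h3, rfl⟩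
        · omega
        · omega
        · omega
        · refine ⟨by omega, fun _ _ => Or.inr ?_⟩
          have h4 := hne h2
          rw [h1] at h4
          rw [stepB_D0 _ _ (by omega)]
          congr 1
          omega
        · refine ⟨by omega, fun _ _ => Or.inr ?_⟩
          change R 1 = _
          congr 1
          omega
        · refine ⟨by omega, fun _ _ => Or.inr ?_⟩
          exact stepB_R _ _ _ (by omega) (by omega)
        · exact ⟨fun _ _ => stepB_N0 _ _ (by omega),
            fun _ _ => Or.inl ⟨by omega, stepB_N _ _ _ (by omega) (by omega)⟩⟩
        · exact ⟨fun _ _ => stepB_N0 _ _ (by omega),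
            fun _ _ => Or.inl ⟨by omega, stepB_N _ _ _ (by omega) (by omega)⟩⟩
      · obtain ⟨s, hs, hx, hc⟩ := ht (j + e) (by omega) (by omega)
        refine ⟨_, hmem s hs, ?_, ?_, by omega, by omega⟩
        · intro _ hj
          rcases hc with ⟨h1, rfl⟩ | ⟨h1, h2, h3, rfl⟩ | ⟨h1, h2, h3, rfl⟩ | hc | hc | hc | hc | hc
          · left
            rw [stepB_D _ _ _ (by omega)]
            congr 1
            omega
          · exact Or.inr ⟨h3, stepB_N0 _ _ (by omega)⟩
          · exact Or.inr ⟨h3, stepB_R0 _ _ (by omega)⟩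
          all_goals omega
        · intro _ hj
          rcases hc with ⟨h1, rfl⟩ | ⟨h1, h2, h3, rfl⟩ | ⟨h1, h2, h3, rfl⟩ | hc | hc | hc | hc | hc
          · left
            rw [stepB_D _ _ _ (by omega)]
            congr 1
            omega
          · exact Or.inr (Or.inl ⟨h3, by omega, stepB_N _ _ _ (by omega) (by omega)⟩)
          · exact Or.inr (Or.inr ⟨h3, stepB_R _ _ _ (by omega) (by omega)⟩)
          all_goals omega
    have key2 : ∀ pre' : Bool, ∀ j, 2 ≤ j → j ≤ k → ∃ s ∈ img k false S,
        Tok k 1 pre' j (if j ≤ k - e then v (j + e) else 2) s := by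
      intro pre' j j2 jk
      obtain ⟨s, hs, -, k2, -, k4⟩ := key j (by omega) jk
      refine ⟨s, hs, ?_⟩
      rcases Nat.lt_or_ge k (j + e) with hje | hje
      · rw [if_neg (by omega)]
        refine ⟨le_rfl, ?_⟩
        rcases k4 hje j2 with ⟨h1, h2⟩ | h2
        · exact Or.inr (Or.inl ⟨by omega, h1, rfl, h2⟩)
        · exact Or.inr (Or.inr (Or.inl ⟨by omega, by omega, rfl, h2⟩))
      · rw [if_pos (by omega)]
        refine ⟨hv2 _ (by omega) hje, ?_⟩
        rcases k2 hje j2 with h2 | ⟨h0, h1, h2⟩ | ⟨h0, h2⟩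
        · exact Or.inl ⟨by omega, h2⟩
        · exact Or.inr (Or.inl ⟨by omega, h1, h0, h2⟩)
        · exact Or.inr (Or.inr (Or.inl ⟨by omega, by omega, h0, h2⟩))
    have key1 : ∃ pre' : Bool, ∃ s ∈ img k false S,
        Tok k 1 pre' 1 (if 1 ≤ k - e then v (1 + e) else 2) s := by
      obtain ⟨s, hs, k1, -, k3, -⟩ := key 1 le_rfl (by omega)
      rcases Nat.lt_or_ge k (1 + e) with hje | hje
      · refine ⟨false, s, hs, ?_⟩
        rw [if_neg (by omega)]
        exact ⟨le_rfl, by simp [k3 hje rfl]⟩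
      · rw [if_pos (by omega)]
        rcases k1 hje rfl with h | ⟨h0, h⟩
        · exact ⟨true, s, hs, hv2 _ (by omega) hje, by simp [h]⟩
        · exact ⟨false, s, hs, hv2 _ (by omega) hje, by simp [h, h0]⟩
    obtain ⟨pre', s1, hs1, ht1⟩ := key1
    refine ⟨1, pre', fun j => if j ≤ k - e then v (j + e) else 2, ⟨by omega, by omega, ?_⟩,
      hpot _ _ (val_rot k e he v hv2)⟩
    intro j j1 jk
    rcases Nat.lt_or_ge 1 j with hj | hj
    · exact key2 pre' j hj jk
    · have : j = 1 := by omega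
      subst this
      exact ⟨s1, hs1, ht1⟩
  · -- the pointer moves on
    have hz : ∀ j, 1 ≤ j → j ≤ e → pre = true ∧ v j = 0 := by
      intro j a b
      have h1 : pre = true ∧ v e = 0 := by
        by_contra h
        exact hrot ⟨by omega, fun h1 h2 => h ⟨h1, h2⟩⟩
      refine ⟨h1.1, ?_⟩
      rcases Nat.lt_or_ge j e with hj | hj
      · obtain ⟨s, hs, hx, hc⟩ := ht j a (by omega)
        have := h1.1
        rcases hc with h | h | h | h | h | h | h | h
        any_goals omega
        simp [this] at h
      · have : j = e := by omega
        rw [this]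
        exact h1.2
    have hek : e < k := by
      by_contra h
      have := val_zero k v (fun j a b => (hz j a (by omega)).2)
      omega
    have low : ∀ j, 1 ≤ j → j ≤ e → N (e + 1 - j) ∈ img k false S := by
      intro j a b
      obtain ⟨hp, h0⟩ := hz j a b
      obtain ⟨s, hs, hx, hc⟩ := ht j a (by omega)
      have hm := hmem s hs
      rcases hc with ⟨h1, rfl⟩ | ⟨h1, h2, h3, rfl⟩ | ⟨h1, h2, h3, rfl⟩ | ⟨h1, h2, rfl⟩ |
          ⟨h1, h2, h3, rfl⟩ | ⟨h1, h2, h3, rfl⟩ | ⟨h1, h2, h3, rfl⟩ | ⟨h1, h2, h3, rfl⟩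
      any_goals omega
      · subst h1
        rw [h0] at hm
        have : e + 1 - e = 1 := by omega
        rw [this]
        exact hm
      · rwa [stepB_N k _ (e + 1 - j) (by omega) (by omega)] at hm
    have high : ∀ pre' : Bool, ∀ j, e + 1 < j → j ≤ k → ∃ s ∈ img k false S,
        Tok k (e + 1) pre' j (v j) s := by
      intro pre' j a b
      obtain ⟨s, hs, hx, hc⟩ := ht j (by omega) (by omega)
      refine ⟨_, hmem s hs, hx, ?_⟩
      rcases hc with ⟨h1, rfl⟩ | ⟨h1, h2, h3, rfl⟩ | ⟨h1, h2, h3, rfl⟩ | hc | hc | hc | hc | hc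
      · left
        refine ⟨a, ?_⟩
        rw [stepB_D _ _ _ (by omega)]
        congr 1
      · exact Or.inr (Or.inl ⟨a, h2, h3, stepB_N _ _ _ (by omega) (by omega)⟩)
      · exact Or.inr (Or.inr (Or.inl ⟨a, by omega, h3, stepB_R _ _ _ (by omega) (by omega)⟩))
      all_goals omega
    obtain ⟨s, hs, hx, hc⟩ := ht (e + 1) (by omega) (by omega)
    have mid : D 0 (v (e + 1)) ∈ img k false S ∨ (v (e + 1) = 2 ∧ R 0 ∈ img k false S) := by
      have hm := hmem s hs
      rcases hc with ⟨h1, rfl⟩ | ⟨h1, h2, h3, rfl⟩ | ⟨h1, h2, h3, rfl⟩ | hc | hc | hc | hc | hc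
      · left
        rw [stepB_D _ _ _ (by omega)] at hm
        have : e + 1 - e - 1 = 0 := by omega
        rwa [this] at hm
      · right
        rw [stepB_N0 _ _ (by omega)] at hm
        exact ⟨h3, hm⟩
      · right
        rw [stepB_R0 _ _ (by omega)] at hm
        exact ⟨h3, hm⟩
      all_goals omega
    rcases mid with hm | ⟨h2, hm⟩
    · refine ⟨e + 1, true, v, ⟨by omega, by omega, ?_⟩, hpot _ _ le_rfl⟩
      intro j j1 jk
      rcases Nat.lt_trichotomy j (e + 1) with hj | hj | hj
      · refine ⟨_, low j j1 (by omega), by have := (hz j j1 (by omega)).2; omega, ?_⟩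
        have := (hz j j1 (by omega)).2
        right; right; right; right; right; right; left
        exact ⟨hj, rfl, this, rfl⟩
      · subst hj
        refine ⟨_, hm, hx, ?_⟩
        right; right; right; left
        exact ⟨rfl, rfl, rfl⟩
      · exact high true j hj jk
    · refine ⟨e + 1, false, fun j => if j < e + 1 then 2 else v j, ⟨by omega, by omega, ?_⟩,
        hpot _ _ (val_mono _ _ _ ?_)⟩
      · intro j j1 jk
        rcases Nat.lt_trichotomy j (e + 1) with hj | hj | hj
        · refine ⟨_, low j j1 (by omega), ?_⟩
          simp only [if_pos hj]
          refine ⟨le_rfl, ?_⟩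
          right; right; right; right; right; right; right
          exact ⟨hj, rfl, rfl, rfl⟩
        · subst hj
          refine ⟨_, hm, ?_⟩
          simp only [lt_self_iff_false, if_false]
          refine ⟨hx, ?_⟩
          right; right; right; right; right; left
          exact ⟨rfl, rfl, h2, rfl⟩
        · simp only [if_neg (show ¬ j < e + 1 by omega)]
          exact high false j hj jk
      · intro j a b
        split_ifs
        · exact hv2 j a b
        · exact le_rfl

theorem lower_aux {k : ℕ} (hk : 2 ≤ k) (w : List Bool) : ∀ (e : ℕ) (pre : Bool) (v : ℕ → ℕ)
    (S : Set CSt), Inv k e pre v S → 2 * 3 ^ (k - 1) + w.length ≤ pot k pre v →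
    ∀ q₀ : CSt, (∀ s ∈ S, run k w s = some q₀) → False := by
  induction w with
  | nil =>
    intro e pre v S hI _ q₀ hq
    obtain ⟨s1, hs1, ht1⟩ := hI.2.2 1 le_rfl (by omega)
    obtain ⟨s2, hs2, ht2⟩ := hI.2.2 2 (by omega) hk
    have h1 := hq s1 hs1
    have h2 := hq s2 hs2
    simp only [run, Option.some.injEq] at h1 h2
    rw [h1] at ht1
    rw [h2] at ht2
    exact tok_distinct hk hI.1 ht1 ht2
  | cons l w ih =>
    intro e pre v S hI hp q₀ hq
    have hV : 3 ^ (k - 1) ≤ val k v := by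
      simp only [pot, List.length_cons] at hp
      split_ifs at hp <;> omega
    have hd : ∀ s ∈ S, step k l s ≠ none := by
      intro s hs h
      have := hq s hs
      simp [run, h] at this
    have hq' : ∀ s ∈ img k l S, run k w s = some q₀ := by
      rintro s ⟨s0, hs0, h⟩
      have := hq s0 hs0
      simpa [run, h] using this
    have hex : ∃ e' pre' v', Inv k e' pre' v' (img k l S) ∧ pot k pre v ≤ pot k pre' v' + 1 := by
      cases l
      · exact inv_stepB hk hI hV
      · exact inv_stepA hk hI hd hV
    obtain ⟨e', pre', v', hI', hp'⟩ := hex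
    refine ih e' pre' v' _ hI' ?_ q₀ hq'
    simp only [List.length_cons] at hp
    omega

theorem lower {k : ℕ} (hk : 2 ≤ k) (w : List Bool) (q₀ : CSt)
    (h : ∀ s, Valid k s → run k w s = some q₀) : 3 ^ k ≤ w.length := by
  by_contra hl
  refine lower_aux hk w 0 false (fun _ => 2) {s | Valid k s} ⟨by omega, by simp, ?_⟩ ?_ q₀ h
  · intro j j1 jk
    refine ⟨D j 2, ⟨jk, le_rfl⟩, le_rfl, Or.inl ⟨by omega, rfl⟩⟩
  · have h2 := val_two k (fun _ => 2) (fun _ _ _ => rfl)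
    have h3 : 3 ^ k = 3 * 3 ^ (k - 1) := by
      rw [← pow_succ']
      congr 1
      omega
    have h4 : 0 < 3 ^ (k - 1) := by positivity
    simp only [pot]
    simp
    omega

/-! ### Existence of a synchronising word -/

theorem run_append (k : ℕ) (u w : List Bool) (s : CSt) :
    run k (u ++ w) s = (run k u s).bind (run k w) := by
  induction u generalizing s with
  | nil => rfl
  | cons l u ih =>
    simp only [List.cons_append, run]
    cases step k l s with
    | none => rfl
    | some s' => exact ih s'

theorem run_trans {k : ℕ} {u w : List Bool} {s s' s'' : CSt} (h1 : run k u s = some s')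
    (h2 : run k w s' = some s'') : run k (u ++ w) s = some s'' := by
  rw [run_append, h1]
  exact h2

theorem run_b_D (k c p x : ℕ) : run k (List.replicate c false) (D (p + c) x) = some (D p x) := by
  induction c with
  | zero => rfl
  | succ c ih => exact ih

theorem run_b_N (k c t : ℕ) (h : t + c < k) :
    run k (List.replicate c false) (N t) = some (N (t + c)) := by
  induction c generalizing t with
  | zero => rfl
  | succ c ih =>
    simp only [List.replicate_succ, run, step, Option.bind_some]
    rw [stepB_N k t (t + 1) (by omega) rfl, ih (t + 1) (by omega)]
    congr 2
    omega

theorem run_a_D (k c p x : ℕ) (h1 : 1 ≤ p) (h : p + c ≤ k) :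
    run k (List.replicate c true) (D p x) = some (D (p + c) x) := by
  induction c generalizing p with
  | zero => rfl
  | succ c ih =>
    obtain ⟨p, rfl⟩ := Nat.exists_eq_add_of_le' h1
    simp only [List.replicate_succ, run, step, stepA]
    rw [if_pos (by omega), Option.bind_some, ih (p + 2) (by omega) (by omega)]
    congr 2
    omega

theorem run_a_N (k c : ℕ) :
    run k (List.replicate c true) (N (c + 1)) = some (N 1) := by
  induction c with
  | zero => rfl
  | succ c ih => exact ih

/-- Shift `m + 1` places and back. -/
def dw (m : ℕ) : List Bool := List.replicate (m + 1) false ++ List.replicate (m + 1) true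

theorem dw_high (k m j x : ℕ) (h : m + 1 < j) (hj : j ≤ k) :
    run k (dw m) (D j x) = some (D j x) := by
  obtain ⟨p, rfl⟩ := Nat.exists_eq_add_of_le' h.le
  exact run_trans (run_b_D k (m + 1) p x) (run_a_D k (m + 1) p x (by omega) hj)

theorem dw_mid (k m x : ℕ) (h : m + 1 ≤ k) :
    run k (dw m) (D (m + 1) (x + 1)) = some (D (m + 1) x) := by
  have h1 := run_b_D k (m + 1) 0 (x + 1)
  rw [zero_add] at h1
  refine run_trans h1 ?_
  have h2 := run_a_D k m 1 x le_rfl (by omega)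
  rw [add_comm 1 m] at h2
  exact h2

theorem dw_low (k m j : ℕ) (h : m + 1 ≤ k) (j1 : 1 ≤ j) (jm : j ≤ m) :
    run k (dw m) (D j 0) = some (D j 2) := by
  obtain ⟨c, rfl⟩ := Nat.exists_eq_add_of_le jm
  obtain ⟨i, rfl⟩ := Nat.exists_eq_add_of_le' j1
  have e1 : List.replicate (i + 1 + c + 1) false
      = List.replicate (i + 1) false ++ ([false] ++ List.replicate c false) := by
    rw [← List.replicate_one, ← List.replicate_add, ← List.replicate_add]
    congr 1
    omega
  have e2 : List.replicate (i + 1 + c + 1) true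
      = List.replicate c true ++ ([true, true] ++ List.replicate i true) := by
    have : [true, true] = List.replicate 2 true := rfl
    rw [this, ← List.replicate_add, ← List.replicate_add]
    congr 1
    omega
  have h1 := run_b_D k (i + 1) 0 0
  rw [zero_add] at h1
  have h2 : run k [false] (D 0 0) = some (N 1) := rfl
  have h3 := run_b_N k c 1 (by omega)
  have h4 := run_a_N k c
  rw [add_comm c 1] at h4
  have h5 : run k [true, true] (N 1) = some (D 1 2) := rfl
  have h6 := run_a_D k i 1 2 le_rfl (by omega)
  rw [add_comm 1 i] at h6
  unfold dw
  rw [e1, e2]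
  exact run_trans (run_trans h1 (run_trans h2 h3)) (run_trans h4 (run_trans h5 h6))

/-- Counting the lowest `m` digits down to zero. -/
def cw : ℕ → List Bool
  | 0 => []
  | m + 1 => cw m ++ (dw m ++ (cw m ++ (dw m ++ cw m)))

theorem cw_spec (k m : ℕ) (h : m ≤ k) :
    (∀ j, 1 ≤ j → j ≤ m → run k (cw m) (D j 2) = some (D j 0)) ∧
    (∀ j x, m < j → j ≤ k → run k (cw m) (D j x) = some (D j x)) := by
  induction m with
  | zero => exact ⟨fun j a b => by omega, fun j x _ _ => rfl⟩
  | succ m ih =>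
    obtain ⟨ih1, ih2⟩ := ih (by omega)
    refine ⟨fun j a b => ?_, fun j x a b => ?_⟩
    · rcases Nat.lt_or_ge m j with hj | hj
      · have : j = m + 1 := by omega
        subst this
        exact run_trans (ih2 _ 2 hj h) (run_trans (dw_mid k m 1 h) (run_trans (ih2 _ 1 hj h)
          (run_trans (dw_mid k m 0 h) (ih2 _ 0 hj h))))
      · exact run_trans (ih1 j a hj) (run_trans (dw_low k m j h a hj) (run_trans (ih1 j a hj)
          (run_trans (dw_low k m j h a hj) (ih1 j a hj))))
    · exact run_trans (ih2 j x (by omega) b) (run_trans (dw_high k m j x a b)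
        (run_trans (ih2 j x (by omega) b) (run_trans (dw_high k m j x a b)
        (ih2 j x (by omega) b))))

/-- Pushing all the digits one place up. -/
def uw (m : ℕ) : List Bool := cw m ++ (dw m ++ (cw m ++ (dw m ++ [true])))

theorem uw_spec (m j : ℕ) (a : 1 ≤ j) (b : j ≤ m + 1) :
    run (m + 1) (uw m) (D j 2) = some (D (min (j + 1) (m + 1)) 2) := by
  obtain ⟨c1, c2⟩ := cw_spec (m + 1) m (by omega)
  rcases Nat.lt_or_ge m j with hj | hj
  · have : j = m + 1 := by omega
    subst this
    have e : min (m + 1 + 1) (m + 1) = m + 1 := by omega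
    rw [e]
    refine run_trans (c2 _ 2 hj b) (run_trans (dw_mid _ m 1 le_rfl) (run_trans (c2 _ 1 hj b)
          (run_trans (dw_mid _ m 0 le_rfl) ?_)))
    simp [run, step, stepA]
  · have e : min (j + 1) (m + 1) = j + 1 := by omega
    rw [e]
    exact run_trans (c1 j a hj) (run_trans (dw_low _ m j le_rfl a hj) (run_trans (c1 j a hj)
          (run_trans (dw_low _ m j le_rfl a hj) (run_a_D _ 1 j 2 a (by omega)))))

/-- Repeated pushing. -/
def vw (m : ℕ) : ℕ → List Bool
  | 0 => []
  | i + 1 => uw m ++ vw m i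

theorem vw_spec (m i j : ℕ) (a : 1 ≤ j) (b : j ≤ m + 1) (c : m + 1 ≤ j + i) :
    run (m + 1) (vw m i) (D j 2) = some (D (m + 1) 2) := by
  induction i generalizing j with
  | zero =>
    have : j = m + 1 := by omega
    subst this
    rfl
  | succ i ih =>
    exact run_trans (uw_spec m j a b) (ih _ (by omega) (by omega) (by omega))

/-- Distance to the reset ring. -/
def dist0 (k : ℕ) : CSt → ℕ
  | D p _ => k + p + 1
  | E => 1
  | N t => k - t
  | R _ => 0

theorem reset {k : ℕ} (hk : 2 ≤ k) (M : ℕ) (s : CSt) (hs : Valid k s) (h : dist0 k s ≤ M) :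
    ∃ t, t < k ∧ run k (List.replicate M false) s = some (R t) := by
  induction M generalizing s with
  | zero =>
    cases s with
    | D p x => simp [dist0] at h
    | E => simp [dist0] at h
    | N t => simp only [dist0, Valid] at h hs; omega
    | R t => exact ⟨t, hs, rfl⟩
  | succ M ih =>
    have hs' := valid_step hk false s _ hs rfl
    have := ih (stepB k s) hs' (by
      rcases s with ⟨_ | p, _ | x⟩ | _ | t | t <;> simp only [stepB, Valid] at * <;>
      (try split_ifs) <;> simp only [dist0] at * <;> omega)
    exact this

theorem exists_sync {k : ℕ} (hk : 2 ≤ k) :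
    ∃ w q₀, ∀ s, Valid k s → run k w s = some q₀ := by
  obtain ⟨m, rfl⟩ := Nat.exists_eq_add_of_le' (show 1 ≤ k by omega)
  refine ⟨List.replicate (2 * (m + 1) + 1) false ++ ([true] ++ vw m m), D (m + 1) 2, ?_⟩
  intro s hs
  obtain ⟨t, ht, h⟩ := reset hk (2 * (m + 1) + 1) s hs (by
    cases s <;> simp only [dist0, Valid] at * <;> omega)
  refine run_trans h ?_
  cases t with
  | zero =>
    have h1 : run (m + 1) [true] (R 0) = some (D 1 2) := rfl
    exact run_trans h1 (vw_spec m m 1 le_rfl (by omega) (by omega))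
  | succ t =>
    have h1 : run (m + 1) [true] (R (t + 1)) = some (D (m + 1 - t) 2) := rfl
    exact run_trans h1 (vw_spec m m _ (by omega) (by omega) (by omega))

/-! ### Transport to `Fin n` -/

/-- Numbering of the states. -/
def enc (k : ℕ) : CSt → ℕ
  | D p x => 3 * p + x
  | E => 3 * k + 3
  | N t => 3 * k + 3 + t
  | R t => 4 * k + 3 + t

/-- Inverse numbering. -/
def dec (k i : ℕ) : CSt :=
  if i < 3 * k + 3 then D (i / 3) (i % 3)
  else if i = 3 * k + 3 then E
  else if i < 4 * k + 3 then N (i - (3 * k + 3))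
  else R (i - (4 * k + 3))

theorem dec_valid {k i : ℕ} (h : i < 5 * k + 3) : Valid k (dec k i) := by
  unfold dec
  split_ifs <;> simp only [Valid] <;> omega

theorem enc_dec {k i : ℕ} : enc k (dec k i) = i := by
  unfold dec
  split_ifs <;> simp only [enc] <;> omega

theorem enc_lt {k : ℕ} (hk : 2 ≤ k) {s : CSt} (h : Valid k s) : enc k s < 5 * k + 3 := by
  cases s <;> simp only [Valid, enc] at * <;> omega

theorem dec_enc {k : ℕ} (hk : 2 ≤ k) {s : CSt} (h : Valid k s) : dec k (enc k s) = s := by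
  generalize hi : enc k s = i
  unfold dec
  cases s <;> simp only [Valid] at h <;> simp only [enc] at hi
  · rw [if_pos (by omega)]
    congr 1 <;> omega
  · rw [if_neg (by omega), if_pos (by omega)]
  · rw [if_neg (by omega), if_neg (by omega), if_pos (by omega)]
    congr 1
    omega
  · rw [if_neg (by omega), if_neg (by omega), if_neg (by omega)]
    congr 1
    omega

/-- The letters as partial transformations of `Fin n`. -/
def letter (k n : ℕ) (l : Bool) (q : Fin n) : Option (Fin n) :=
  (step k l (dec k q.1)).bind fun s => if h : enc k s < n then some ⟨enc k s, h⟩ else none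

theorem foldl_none {n : ℕ} (w : List (Fin n → Option (Fin n))) :
    w.foldl (fun o f => o.bind f) none = none := by
  induction w with
  | nil => rfl
  | cons f w ih => exact ih

theorem ptApply_cons {n : ℕ} (f : Fin n → Option (Fin n)) (w : List (Fin n → Option (Fin n)))
    (q : Fin n) : ptApply (f :: w) q = (f q).bind (ptApply w) := by
  simp only [ptApply, List.foldl_cons, Option.bind_some]
  cases f q with
  | none => exact foldl_none w
  | some q' => rfl

theorem ptApply_letter {k n : ℕ} (hk : 2 ≤ k) (hn : n = 5 * k + 3) (w : List Bool) (q : Fin n) :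
    (ptApply (w.map (letter k n)) q).map (fun q => dec k q.1) = run k w (dec k q.1) := by
  induction w generalizing q with
  | nil => rfl
  | cons l w ih =>
    rw [List.map_cons, ptApply_cons]
    simp only [run, letter]
    cases h : step k l (dec k q.1) with
    | none => rfl
    | some s =>
      have hv := valid_step hk l _ s (dec_valid (by omega)) h
      have hl := enc_lt hk hv
      rw [← hn] at hl
      simp only [Option.bind_some, dif_pos hl]
      rw [ih]
      simp only [dec_enc hk hv]

theorem main {k n : ℕ} (hk : 2 ≤ k) (hn : n = 5 * k + 3) :
    ∃ A : Finset (Fin n → Option (Fin n)),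
      A.card = 2 ∧ (∃ w, CarefullySync A w) ∧ (∀ w, CarefullySync A w → 3 ^ k ≤ w.length) := by
  classical
  refine ⟨{letter k n true, letter k n false}, ?_, ?_, ?_⟩
  · apply Finset.card_pair
    intro h
    have h0 : (0 : ℕ) < n := by omega
    have h1 := congrFun h ⟨0, h0⟩
    have h2 : dec k 0 = D 0 0 := by simp [dec]
    simp only [letter, h2, step, stepA, stepB, Option.bind_none, Option.bind_some] at h1
    rw [dif_pos (by simp only [enc]; omega)] at h1
    simp at h1
  · obtain ⟨w, s₀, h⟩ := exists_sync hk
    refine ⟨w.map (letter k n), ?_, ?_⟩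
    · intro g hg
      obtain ⟨l, -, rfl⟩ := List.mem_map.1 hg
      cases l <;> simp
    · have key : ∀ q : Fin n, ∃ hl : enc k s₀ < n,
          ptApply (w.map (letter k n)) q = some ⟨enc k s₀, hl⟩ := by
        intro q
        have h1 := ptApply_letter hk hn w q
        rw [h _ (dec_valid (by omega))] at h1
        obtain ⟨q', h2, h3⟩ := Option.map_eq_some_iff.1 h1
        subst h3
        simp only [enc_dec]
        exact ⟨q'.2, h2⟩
      obtain ⟨hl, -⟩ := key ⟨0, by omega⟩
      exact ⟨⟨enc k s₀, hl⟩, fun q => (key q).2⟩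
  · rintro w ⟨hA, q₀, hq⟩
    have hw : ∃ u : List Bool, w = u.map (letter k n) := by
      clear hq
      induction w with
      | nil => exact ⟨[], rfl⟩
      | cons g w ih =>
        obtain ⟨u, rfl⟩ := ih (fun g' hg' => hA g' (List.mem_cons_of_mem _ hg'))
        have hg := hA g List.mem_cons_self
        simp only [Finset.mem_insert, Finset.mem_singleton] at hg
        rcases hg with rfl | rfl
        · exact ⟨true :: u, rfl⟩
        · exact ⟨false :: u, rfl⟩
    obtain ⟨u, rfl⟩ := hw
    rw [List.length_map]
    refine lower hk u (dec k q₀.1) ?_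
    intro s hs
    have hl := enc_lt hk hs
    rw [← hn] at hl
    have h1 := ptApply_letter hk hn u ⟨enc k s, hl⟩
    rw [hq] at h1
    simp only [dec_enc hk hs] at h1
    rw [← h1]
    rfl

/-- The degenerate case of a single digit. -/
theorem main_one : ∃ A : Finset (Fin 8 → Option (Fin 8)),
      A.card = 2 ∧ (∃ w, CarefullySync A w) ∧ (∀ w, CarefullySync A w → 3 ≤ w.length) := by
  classical
  let f : Fin 8 → Option (Fin 8) := fun q => some (if q = 7 then 7 else q + 1)
  let g : Fin 8 → Option (Fin 8) := fun _ => none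
  have hfg : f ≠ g := by
    intro h
    have := congrFun h 0
    simp [f, g] at this
  refine ⟨{f, g}, Finset.card_pair hfg, ⟨List.replicate 7 f, ?_, 7, ?_⟩, ?_⟩
  · intro x hx
    rw [List.eq_of_mem_replicate hx]
    simp
  · intro q
    fin_cases q <;> rfl
  · rintro w ⟨hA, q₀, hq⟩
    have hall : ∀ u : List (Fin 8 → Option (Fin 8)), (∀ x ∈ u, x = f ∨ x = g) →
        u.length < 3 → ptApply u 0 = ptApply u 7 → ptApply u 0 ≠ none → False := by
      intro u hu hl h1 h2
      rcases u with _ | ⟨x, _ | ⟨y, _ | ⟨z, u⟩⟩⟩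
      · exact absurd h1 (by decide)
      · rcases hu x (by simp) with rfl | rfl
        · exact absurd h1 (by decide)
        · exact h2 rfl
      · rcases hu x (by simp) with rfl | rfl
        · rcases hu y (by simp) with rfl | rfl
          · exact absurd h1 (by decide)
          · exact h2 rfl
        · exact h2 (by rw [ptApply_cons]; rfl)
      · simp only [List.length_cons] at hl
        omega
    by_contra hl
    refine hall w (fun x hx => by simpa using hA x hx) (by omega) ((hq 0).trans (hq 7).symm) ?_
    rw [hq 0]
    simp

end CSt

/-- For every `n ≥ 8` with `n ≡ 3 (mod 5)`, there is an alphabet of `2` partial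
transformations of an `n`-element set admitting a carefully synchronising word, all of whose
carefully synchronising words have length at least `3 ^ ((n - 3) / 5)`
(simulating a decrementing ternary counter with `(n - 3) / 5` digits over a binary alphabet). -/
theorem car_lower_bound_binary_ternary_counter (n : ℕ) (hn : 8 ≤ n) (hmod : n % 5 = 3) :
    ∃ A : Finset (Fin n → Option (Fin n)),
      A.card = 2 ∧
      (∃ w, CarefullySync A w) ∧
      (∀ w, CarefullySync A w → 3 ^ ((n - 3) / 5) ≤ w.length) := by
  obtain ⟨k, hk⟩ : ∃ k, n = 5 * k + 3 := ⟨n / 5, by omega⟩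
  have e : (n - 3) / 5 = k := by omega
  rw [e]
  rcases Nat.lt_or_ge k 2 with h | h
  · have h1 : k = 1 := by omega
    subst h1
    subst hk
    exact CSt.main_one
  · exact CSt.main h hk
end
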